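/- For every finite simple graph H, the following four statements are equivalent, where 𝒢 denotes the class of all finite simple graphs that do not contain H as an induced minor: (1) 𝒢 is tame; (2) 𝒢 is not feral; (3) H is isomorphic to an induced subgraph of the diamond, the butterfly, or the house; (4) H is an induced minor of the butterfly or of the house. -/

import Mathlib

open SimpleGraph

/-! ### Minimal separators, tame and feral classes -/

/-- `S` separates `a` from `b` in `G`: `a, b` lie in distinct connected components of `G − S`,
i.e. every walk from `a` to `b` meets `S`. -/
def Separates {V : Type} (G : SimpleGraph V) (S : Set V) (a b : V) : Prop :=
  ∀ p : G.Walk a b, ∃ x ∈ p.support, x ∈ S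

/-- `S` is a minimal separator of `G`: some nonadjacent pair `a, b` outside `S` lies in distinct
components of `G − S`, while for every proper subset `S' ⊊ S` they lie in the same component
of `G − S'`. -/
def IsMinimalSeparator {V : Type} (G : SimpleGraph V) (S : Set V) : Prop :=
  ∃ a b : V, a ∉ S ∧ b ∉ S ∧ a ≠ b ∧ ¬ G.Adj a b ∧ Separates G S a b ∧
    ∀ S' : Set V, S' ⊂ S → ¬ Separates G S' a b

/-- The number of minimal separators of a graph on `Fin n`. -/
noncomputable def numMinSep {n : ℕ} (G : SimpleGraph (Fin n)) : ℕ :=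
  {S : Set (Fin n) | IsMinimalSeparator G S}.ncard

/-- A class of finite simple graphs (one collection for each number of vertices) is tame if
some polynomial bounds the number of minimal separators of all its members. -/
def Tame (𝒢 : ∀ n : ℕ, SimpleGraph (Fin n) → Prop) : Prop :=
  ∃ p : Polynomial ℕ, ∀ (n : ℕ) (G : SimpleGraph (Fin n)), 𝒢 n G → numMinSep G ≤ p.eval n

/-- A class of finite simple graphs is feral if for some real `c > 1` there are infinitely many
graphs `G` in the class with at least `c ^ |V(G)|` minimal separators. -/
def Feral (𝒢 : ∀ n : ℕ, SimpleGraph (Fin n) → Prop) : Prop :=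
  ∃ c : ℝ, 1 < c ∧ ∀ N : ℕ, ∃ n : ℕ, N ≤ n ∧
    ∃ G : SimpleGraph (Fin n), 𝒢 n G ∧ (c ^ n : ℝ) ≤ (numMinSep G : ℝ)

/-! ### Minors and induced minors via models -/

/-- An induced minor model of `H` in `G`. -/
def IsInducedMinorModel {V W : Type} (G : SimpleGraph V) (H : SimpleGraph W)
    (X : W → Set V) : Prop :=
  (∀ w, (X w).Nonempty) ∧
  (∀ w, (G.induce (X w)).Connected) ∧
  (Pairwise fun u w => Disjoint (X u) (X w)) ∧
  (∀ u w, H.Adj u w → ∃ a ∈ X u, ∃ b ∈ X w, G.Adj a b) ∧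
  (∀ u w, u ≠ w → ¬ H.Adj u w → ∀ a ∈ X u, ∀ b ∈ X w, ¬ G.Adj a b)

/-- `H` is an induced minor of `G`. -/
def InducedMinor {V W : Type} (H : SimpleGraph W) (G : SimpleGraph V) : Prop :=
  ∃ X : W → Set V, IsInducedMinorModel G H X

/-- A minor model of `H` in `G` (edges between branch sets of nonadjacent vertices allowed). -/
def IsMinorModel {V W : Type} (G : SimpleGraph V) (H : SimpleGraph W)
    (X : W → Set V) : Prop :=
  (∀ w, (X w).Nonempty) ∧
  (∀ w, (G.induce (X w)).Connected) ∧
  (Pairwise fun u w => Disjoint (X u) (X w)) ∧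
  (∀ u w, H.Adj u w → ∃ a ∈ X u, ∃ b ∈ X w, G.Adj a b)

/-- `H` is a minor of `G`. -/
def IsMinorOf {V W : Type} (H : SimpleGraph W) (G : SimpleGraph V) : Prop :=
  ∃ X : W → Set V, IsMinorModel G H X

/-! ### Subdivisions -/

/-- The graph obtained from `H` by subdividing the edge `uv`: the new vertex is `none`, it is
joined to `u` and `v`, the edge `uv` is removed and everything else is unchanged. -/
def subdivideEdge {W : Type} (H : SimpleGraph W) (u v : W) : SimpleGraph (Option W) :=
  SimpleGraph.fromRel fun x y =>
    (∃ a b : W, x = some a ∧ y = some b ∧ H.Adj a b ∧ ¬(a = u ∧ b = v) ∧ ¬(a = v ∧ b = u)) ∨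
    (x = none ∧ (y = some u ∨ y = some v))

/-- `Subdivision H H'` holds when `H'` is obtained from `H` by repeatedly subdividing edges. -/
inductive Subdivision : {A : Type} → SimpleGraph A → {B : Type} → SimpleGraph B → Prop where
  | refl {A : Type} (G : SimpleGraph A) : Subdivision G G
  | step {A : Type} {G : SimpleGraph A} {B : Type} {H : SimpleGraph B} {u v : B} :
      Subdivision G H → H.Adj u v → Subdivision G (subdivideEdge H u v)

/-- `G` contains an induced subdivision of `H`, i.e. `H` is an induced topological minor
of `G`: some subdivision of `H` is isomorphic to an induced subgraph of `G`. -/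
def ContainsInducedSubdivision {A V : Type} (H : SimpleGraph A) (G : SimpleGraph V) : Prop :=
  ∃ (B : Type) (H' : SimpleGraph B), Subdivision H H' ∧ Nonempty (H' ↪g G)

/-! ### Particular graphs -/

/-- `2P₂`: the disjoint union of two edges. -/
def twoP2 : SimpleGraph (Fin 4) :=
  SimpleGraph.fromRel fun v w => (v = 0 ∧ w = 1) ∨ (v = 2 ∧ w = 3)

/-- The diamond: `K₄` minus the edge `03`. -/
def diamond : SimpleGraph (Fin 4) :=
  SimpleGraph.fromRel fun v w => ¬(v = 0 ∧ w = 3) ∧ ¬(v = 3 ∧ w = 0)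

/-- The butterfly: two triangles `{0,1,2}` and `{0,3,4}` sharing the vertex `0`. -/
def butterfly : SimpleGraph (Fin 5) :=
  SimpleGraph.fromRel fun v w =>
    (v = 0 ∧ w = 1) ∨ (v = 0 ∧ w = 2) ∨ (v = 1 ∧ w = 2) ∨
    (v = 0 ∧ w = 3) ∨ (v = 0 ∧ w = 4) ∨ (v = 3 ∧ w = 4)

/-- The house: the `5`-cycle `0-1-2-3-4-0` together with the chord `03`. -/
def house : SimpleGraph (Fin 5) :=
  SimpleGraph.fromRel fun v w =>
    (v = 0 ∧ w = 1) ∨ (v = 1 ∧ w = 2) ∨ (v = 2 ∧ w = 3) ∨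
    (v = 3 ∧ w = 4) ∨ (v = 0 ∧ w = 4) ∨ (v = 0 ∧ w = 3)

/-- `K₃ + P₁`: a triangle together with an isolated vertex. -/
def k3PlusP1 : SimpleGraph (Fin 4) :=
  SimpleGraph.fromRel fun v w => (v = 0 ∧ w = 1) ∨ (v = 0 ∧ w = 2) ∨ (v = 1 ∧ w = 2)

/-- The (short) `k`-theta: vertices `a = inl 0`, `b = inl 1`, `aᵢ = inr (i, 0)`,
`bᵢ = inr (i, 1)`, with edges `a aᵢ`, `aᵢ bᵢ`, `bᵢ b`. -/
def thetaGraph (k : ℕ) : SimpleGraph (Fin 2 ⊕ Fin k × Fin 2) :=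
  SimpleGraph.fromRel fun v w =>
    (∃ i, v = Sum.inl 0 ∧ w = Sum.inr (i, 0)) ∨
    (∃ i, v = Sum.inl 1 ∧ w = Sum.inr (i, 1)) ∨
    (∃ i, v = Sum.inr (i, 0) ∧ w = Sum.inr (i, 1))

/-- The (short) `k`-prism: two `k`-cliques `{(i,0)}` and `{(i,1)}` with a perfect matching. -/
def prismGraph (k : ℕ) : SimpleGraph (Fin k × Fin 2) :=
  SimpleGraph.fromRel fun v w => (v.2 = w.2 ∧ v.1 ≠ w.1) ∨ (v.1 = w.1 ∧ v.2 ≠ w.2)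

/-- The `k`-skinny ladder: paths `p_i = (i,0)`, `q_i = (i,1)`, independent set `r_i = (i,2)`,
with edges `p_i p_{i+1}`, `q_i q_{i+1}`, `p_i r_i`, `q_i r_i`. -/
def skinnyLadder (k : ℕ) : SimpleGraph (Fin k × Fin 3) :=
  SimpleGraph.fromRel fun v w =>
    (v.2 = w.2 ∧ v.2 ≠ 2 ∧ w.1.val = v.1.val + 1) ∨
    (v.1 = w.1 ∧ v.2 ≠ 2 ∧ w.2 = 2)

/-- `gammaGraph p q r` is the graph `Γ` consisting of two vertices `a = inl 0` and `b = inl 1`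
joined by three internally disjoint paths with `p`, `q`, `r` internal vertices respectively
(so of lengths `p+1`, `q+1`, `r+1`); i.e. `Γ_{p+1, q+1, r+1}`. -/
def gammaGraph (p q r : ℕ) : SimpleGraph (Fin 2 ⊕ (Fin p ⊕ (Fin q ⊕ Fin r))) :=
  SimpleGraph.fromRel fun v w =>
    match v, w with
    | Sum.inl x, Sum.inl y => x = 0 ∧ y = 1 ∧ (p = 0 ∨ q = 0 ∨ r = 0)
    | Sum.inl x, Sum.inr (Sum.inl t) => (x = 0 ∧ t.val = 0) ∨ (x = 1 ∧ t.val = p - 1)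
    | Sum.inl x, Sum.inr (Sum.inr (Sum.inl t)) => (x = 0 ∧ t.val = 0) ∨ (x = 1 ∧ t.val = q - 1)
    | Sum.inl x, Sum.inr (Sum.inr (Sum.inr t)) => (x = 0 ∧ t.val = 0) ∨ (x = 1 ∧ t.val = r - 1)
    | Sum.inr (Sum.inl t), Sum.inr (Sum.inl s) => s.val = t.val + 1
    | Sum.inr (Sum.inr (Sum.inl t)), Sum.inr (Sum.inr (Sum.inl s)) => s.val = t.val + 1
    | Sum.inr (Sum.inr (Sum.inr t)), Sum.inr (Sum.inr (Sum.inr s)) => s.val = t.val + 1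
    | _, _ => False

/-- The long twin wheel on a cycle of length `n`: the cycle `0-1-⋯-(n-1)-0` on `Fin n`
together with a center adjacent exactly to the consecutive vertices `0`, `1`, `2`. -/
def longTwinWheel (n : ℕ) : SimpleGraph (Fin n ⊕ Unit) :=
  SimpleGraph.fromRel fun v w =>
    match v, w with
    | Sum.inl a, Sum.inl b => b.val = a.val + 1 ∨ (a.val = n - 1 ∧ b.val = 0)
    | Sum.inl a, Sum.inr _ => a.val = 0 ∨ a.val = 1 ∨ a.val = 2
    | _, _ => False

/-! ### Thin walks -/

/-- A thin walk in `H`: a walk whose vertices are pairwise distinct except that possibly the two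
endpoints coincide, and all of whose internal vertices have degree `2` in `H`. -/
def IsThinWalk {V : Type} (H : SimpleGraph V) {x y : V} (p : H.Walk x y) : Prop :=
  p.support.tail.Nodup ∧ p.support.dropLast.Nodup ∧
    ∀ v ∈ p.support.tail.dropLast, (H.neighborSet v).ncard = 2

/-! ### Creatures -/

/-- A `k`-creature in `G` on the pairwise disjoint nonempty vertex sets `A`, `B`, `X`, `Y`. -/
def IsCreature {V : Type} (G : SimpleGraph V) (k : ℕ) (A B X Y : Set V) : Prop :=
  A.Nonempty ∧ B.Nonempty ∧
  Disjoint A B ∧ Disjoint A X ∧ Disjoint A Y ∧ Disjoint B X ∧ Disjoint B Y ∧ Disjoint X Y ∧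
  (G.induce A).Connected ∧ (G.induce B).Connected ∧
  (∀ a ∈ A, ∀ b ∈ B, ¬ G.Adj a b) ∧
  (∀ a ∈ A, ∀ y ∈ Y, ¬ G.Adj a y) ∧
  (∀ b ∈ B, ∀ x ∈ X, ¬ G.Adj b x) ∧
  (∀ x ∈ X, ∃ a ∈ A, G.Adj x a) ∧
  (∀ y ∈ Y, ∃ b ∈ B, G.Adj y b) ∧
  ∃ (x : Fin k → V) (y : Fin k → V), Function.Injective x ∧ Function.Injective y ∧
    X = Set.range x ∧ Y = Set.range y ∧ ∀ i j, G.Adj (x i) (y j) ↔ i = j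

/-- `G` is `k`-creature-free. -/
def CreatureFree {V : Type} (G : SimpleGraph V) (k : ℕ) : Prop :=
  ¬ ∃ A B X Y : Set V, IsCreature G k A B X Y

/-! ### Distance to minor-closed classes, feedback vertex set number -/

/-- `cFam F G`: the least size of a vertex set `S` such that `G − S` has no minor isomorphic
to a member of the family `F`. -/
noncomputable def cFam {V : Type} (F : ∀ n : ℕ, SimpleGraph (Fin n) → Prop)
    (G : SimpleGraph V) : ℕ :=
  sInf {k | ∃ S : Set V, S.ncard = k ∧
    ∀ (n : ℕ) (H : SimpleGraph (Fin n)), F n H → ¬ IsMinorOf H (G.induce Sᶜ)}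

/-- The feedback vertex set number of `G`. -/
noncomputable def fvs {V : Type} (G : SimpleGraph V) : ℕ :=
  sInf {k | ∃ S : Set V, S.ncard = k ∧ (G.induce Sᶜ).IsAcyclic}

/-! ### Long unichords and long thetas -/

/-- `G` has a long unichord: an edge which is the unique chord of some cycle of length ≥ 5. -/
def HasLongUnichord {V : Type} (G : SimpleGraph V) : Prop :=
  ∃ (v : V) (c : G.Walk v v), c.IsCycle ∧ 5 ≤ c.length ∧
    ∃ a b : V, a ∈ c.support ∧ b ∈ c.support ∧ G.Adj a b ∧ s(a, b) ∉ c.edges ∧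
      ∀ x y : V, x ∈ c.support → y ∈ c.support → G.Adj x y → s(x, y) ∉ c.edges →
        s(x, y) = s(a, b)

/-- `G` is long-theta-free: no induced subgraph of `G` is a theta `Γ_{i,j,k}` with
`i, j, k ≥ 2` and at least one of `i, j, k` at least `3`. -/
def LongThetaFree {V : Type} (G : SimpleGraph V) : Prop :=
  ¬ ∃ i j k : ℕ, 2 ≤ i ∧ 2 ≤ j ∧ 2 ≤ k ∧ (3 ≤ i ∨ 3 ≤ j ∨ 3 ≤ k) ∧
    Nonempty (gammaGraph (i - 1) (j - 1) (k - 1) ↪g G)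

namespace SimpleGraph

variable {V : Type} {G : SimpleGraph V}

/-- A vertex set induces a connected subgraph iff it is nonempty and every nonempty proper subset
of it has an edge to its complement within the set. -/
lemma induce_connected_iff_exists_adj {C : Set V} :
    (G.induce C).Connected ↔ C.Nonempty ∧ ∀ U ⊆ C, U.Nonempty → U ≠ C →
      ∃ u ∈ U, ∃ w ∈ C, w ∉ U ∧ G.Adj u w := by
  constructor
  · intro h
    refine ⟨Set.nonempty_coe_sort.mp h.nonempty, fun U hU ⟨u, hu⟩ hne => ?_⟩
    obtain ⟨w, hwC, hwU⟩ : ∃ w ∈ C, w ∉ U := by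
      by_contra! hcon
      exact hne (hU.antisymm hcon)
    obtain ⟨p⟩ := h.preconnected ⟨u, hU hu⟩ ⟨w, hwC⟩
    obtain ⟨d, -, h1, h2⟩ := p.exists_boundary_dart {x | x.1 ∈ U} hu hwU
    exact ⟨d.fst.1, h1, d.snd.1, d.snd.2, h2, d.adj⟩
  · rintro ⟨⟨c, hc⟩, h⟩
    have key : ∀ v (hv : v ∈ C), (G.induce C).Reachable ⟨c, hc⟩ ⟨v, hv⟩ := by
      by_contra! hcon
      obtain ⟨v, hv, hcv⟩ := hcon
      obtain ⟨u, ⟨huC, hu⟩, w, hw, hwU, huw⟩ :=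
        h {v | ∃ hv : v ∈ C, (G.induce C).Reachable ⟨c, hc⟩ ⟨v, hv⟩} (fun x hx => hx.1)
          ⟨c, hc, Reachable.refl _⟩ (fun heq => hcv ((Set.ext_iff.1 heq v).2 hv).2)
      exact hwU ⟨hw, hu.trans (Adj.reachable (by simpa using huw))⟩
    have : Nonempty C := ⟨⟨c, hc⟩⟩
    exact ⟨fun x y => (key x.1 x.2).symm.trans (key y.1 y.2)⟩

lemma exists_walk_of_induce_connected {C : Set V} (hC : (G.induce C).Connected) {a b : V}
    (ha : a ∈ C) (hb : b ∈ C) : ∃ p : G.Walk a b, ∀ x ∈ p.support, x ∈ C := by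
  obtain ⟨p⟩ := hC.preconnected ⟨a, ha⟩ ⟨b, hb⟩
  refine ⟨p.map (Embedding.induce C).toHom, fun x hx => ?_⟩
  obtain ⟨y, -, rfl⟩ := List.mem_map.1 ((Walk.support_map _ p) ▸ hx)
  exact y.2

lemma induce_singleton_connected (v : V) : (G.induce {v}).Connected :=
  induce_connected_iff_exists_adj.2 ⟨⟨v, rfl⟩, fun _ hU hne hU' =>
    absurd ((Set.subset_singleton_iff_eq.1 hU).resolve_left hne.ne_empty) hU'⟩

lemma induce_insert_connected {C : Set V} (hC : (G.induce C).Connected) {u w : V} (hu : u ∈ C)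
    (h : G.Adj u w) : (G.induce (insert w C)).Connected := by
  rw [Set.insert_eq, Set.union_comm]
  exact connected_induce_union hC.preconnected (induce_singleton_connected w).preconnected hu
    (Set.mem_singleton w) h

/-- A connected subset `U₀` of a connected set `C ⊈ T` with `U₀ ⊆ T` grows to a connected subset of
`C ∩ T` from which an edge leaves `T` within `C`. -/
lemma exists_connected_subset_adj [Finite V] {C T U₀ : Set V} (hC : (G.induce C).Connected)
    (hU₀ : (G.induce U₀).Connected) (hU₀C : U₀ ⊆ C) (hU₀T : U₀ ⊆ T) (h : ¬ C ⊆ T) :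
    ∃ U ⊆ C, U ⊆ T ∧ U₀ ⊆ U ∧ (G.induce U).Connected ∧ ∃ u ∈ U, ∃ w ∈ C, w ∉ T ∧ G.Adj u w := by
  obtain ⟨U, ⟨hUC, hUT, hU₀U, hU⟩, hmax⟩ := (Set.toFinite {U : Set V | U ⊆ C ∧ U ⊆ T ∧ U₀ ⊆ U ∧
    (G.induce U).Connected}).exists_maximal ⟨U₀, hU₀C, hU₀T, subset_rfl, hU₀⟩
  obtain ⟨u, hu, w, hw, hwU, huw⟩ := (induce_connected_iff_exists_adj.1 hC).2 U hUC
    (Set.nonempty_coe_sort.mp hU.nonempty) (by rintro rfl; exact h hUT)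
  refine ⟨U, hUC, hUT, hU₀U, hU, u, hu, w, hw, fun hwT => hwU ?_, huw⟩
  exact hmax (y := insert w U) ⟨Set.insert_subset hw hUC, Set.insert_subset hwT hUT,
    hU₀U.trans (Set.subset_insert _ _), induce_insert_connected hU hu huw⟩
    (Set.subset_insert _ _) (Or.inl rfl)

/-- A connected set with at least two elements has a vertex, different from a prescribed one, whose
removal leaves a connected set. -/
lemma exists_connected_diff_singleton [Finite V] {C : Set V} (hC : (G.induce C).Connected) {r : V}
    (hr : r ∈ C) (hne : C ≠ {r}) : ∃ j ∈ C, j ≠ r ∧ (G.induce (C \ {j})).Connected := by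
  obtain ⟨M, hM⟩ := (Set.toFinite {M : Set V | M ⊆ C ∧ M ≠ C ∧ r ∈ M ∧
    (G.induce M).Connected}).exists_maximal ⟨{r}, by simpa using hr, hne.symm, rfl,
      induce_singleton_connected r⟩
  obtain ⟨⟨hMC, hMne, hrM, hMc⟩, hmax⟩ := hM
  obtain ⟨u, hu, w, hw, hwM, huw⟩ := (induce_connected_iff_exists_adj.1 hC).2 M hMC ⟨r, hrM⟩ hMne
  have heq : insert w M = C := by
    by_contra hcon
    exact hwM (hmax (y := insert w M) ⟨Set.insert_subset hw hMC, hcon, Or.inr hrM,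
      induce_insert_connected hMc hu huw⟩ (Set.subset_insert _ _) (Or.inl rfl))
  refine ⟨w, hw, by rintro rfl; exact hwM hrM, ?_⟩
  rwa [← heq, Set.insert_sdiff_self_of_notMem hwM]

/-- Given at least three marked vertices in a connected set, two of them, `i` and `j`, can be chosen
so that all the other ones lie in a connected set avoiding, but adjacent to, both `i` and `j`. -/
lemma exists_connected_avoiding_pair [Finite V] {C M : Set V} (hC : (G.induce C).Connected)
    (hM : M ⊆ C) (h3 : 3 ≤ M.ncard) :
    ∃ i ∈ M, ∃ j ∈ M, i ≠ j ∧ ∃ K ⊆ C, (G.induce K).Connected ∧ M \ {i, j} ⊆ K ∧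
      i ∉ K ∧ j ∉ K ∧ (∃ k ∈ K, G.Adj i k) ∧ ∃ k ∈ K, G.Adj j k := by
  obtain ⟨T, ⟨hTC, hMT, hT⟩, hmin⟩ := (Set.toFinite {T : Set V | T ⊆ C ∧ M ⊆ T ∧
    (G.induce T).Connected}).exists_minimal ⟨C, subset_rfl, hM, hC⟩
  have hmark : ∀ i ∈ T, (G.induce (T \ {i})).Connected → i ∈ M := by
    intro i hi hconn
    by_contra hiM
    have := hmin (y := T \ {i}) ⟨Set.sdiff_subset.trans hTC,
      fun x hx => ⟨hMT hx, by rintro rfl; exact hiM hx⟩, hconn⟩ Set.sdiff_subset hi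
    exact this.2 rfl
  have hT3 : 3 ≤ T.ncard := h3.trans (Set.ncard_le_ncard hMT)
  obtain ⟨r, hr⟩ := (induce_connected_iff_exists_adj.1 hT).1
  obtain ⟨i, hi, -, hTi⟩ := exists_connected_diff_singleton hT hr (by
    rintro rfl; simp at hT3)
  have hTi2 : 2 ≤ (T \ {i}).ncard := by
    have := Set.ncard_sdiff_singleton_add_one hi; omega
  obtain ⟨i', hi', s, hs, hsi, his⟩ := (induce_connected_iff_exists_adj.1 hT).2 {i}
    (by simpa using hi) ⟨i, rfl⟩ (by rintro rfl; simp at hT3)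
  obtain rfl : i' = i := hi'
  have hsT : s ∈ T \ {i'} := ⟨hs, hsi⟩
  obtain ⟨j, hj, hjs, hK⟩ := exists_connected_diff_singleton hTi hsT (by
    intro heq; rw [heq] at hTi2; simp at hTi2)
  have hsK : s ∈ (T \ {i'}) \ {j} := ⟨hsT, fun h => hjs h.symm⟩
  refine ⟨i', hmark _ hi hTi, j, hmark j hj.1 ?_, fun h => hj.2 h.symm, (T \ {i'}) \ {j},
    fun x hx => hTC hx.1.1, hK, ?_, by simp, by simp, ⟨s, hsK, his⟩, ?_⟩
  · have := induce_insert_connected hK hsK his.symm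
    rwa [show insert i' ((T \ {i'}) \ {j}) = T \ {j} by
      ext x; have := hj.2; grind] at this
  · intro x hx
    have := hMT hx.1
    grind
  · obtain ⟨j', hj', k, hk, hkj, hjk⟩ := (induce_connected_iff_exists_adj.1 hTi).2 {j}
      (by simpa using hj) ⟨j, rfl⟩ (by intro heq; rw [← heq] at hTi2; simp at hTi2)
    obtain rfl : j' = j := hj'
    exact ⟨k, ⟨hk, hkj⟩, hjk⟩

end SimpleGraph

/-! ### Full components -/

/-- `C` and `D` are two distinct full components of `G − S`: connected components of `G − S` such
that every vertex of `S` has a neighbour in both. -/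
structure IsFullPair {V : Type} (G : SimpleGraph V) (S C D : Set V) : Prop where
  connected_left : (G.induce C).Connected
  connected_right : (G.induce D).Connected
  notMem_right : ∀ v ∈ C, v ∉ D
  left_notMem : ∀ v ∈ C, v ∉ S
  right_notMem : ∀ v ∈ D, v ∉ S
  left_closed : ∀ v ∈ C, ∀ w, G.Adj v w → w ∈ C ∨ w ∈ S
  right_closed : ∀ v ∈ D, ∀ w, G.Adj v w → w ∈ D ∨ w ∈ S
  left_full : ∀ s ∈ S, ∃ c ∈ C, G.Adj c s
  right_full : ∀ s ∈ S, ∃ d ∈ D, G.Adj d s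

namespace IsFullPair

variable {V : Type} {G : SimpleGraph V} {S C D : Set V}

lemma symm (h : IsFullPair G S C D) : IsFullPair G S D C :=
  ⟨h.connected_right, h.connected_left, fun v hD hC => h.notMem_right v hC hD, h.right_notMem,
    h.left_notMem, h.right_closed, h.left_closed, h.right_full, h.left_full⟩

lemma not_adj (h : IsFullPair G S C D) {c d : V} (hc : c ∈ C) (hd : d ∈ D) : ¬ G.Adj c d :=
  fun hcd => (h.left_closed c hc d hcd).elim (fun h' => h.notMem_right d h' hd)
    (h.right_notMem d hd)

lemma isMinimalSeparator (h : IsFullPair G S C D) : IsMinimalSeparator G S := by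
  obtain ⟨a, ha⟩ := Set.nonempty_coe_sort.mp h.connected_left.nonempty
  obtain ⟨b, hb⟩ := Set.nonempty_coe_sort.mp h.connected_right.nonempty
  refine ⟨a, b, h.left_notMem a ha, h.right_notMem b hb, ?_, h.not_adj ha hb, ?_, ?_⟩
  · rintro rfl
    exact h.notMem_right a ha hb
  · intro p
    obtain ⟨d, hd, h1, h2⟩ := p.exists_boundary_dart C ha (fun hbC => h.notMem_right b hbC hb)
    exact ⟨d.snd, p.dart_snd_mem_support_of_mem_darts hd,
      (h.left_closed _ h1 _ d.adj).resolve_left h2⟩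
  · intro S' hS' hsep
    obtain ⟨s, hs, hsS'⟩ := Set.exists_of_ssubset hS'
    obtain ⟨c, hc, hcs⟩ := h.left_full s hs
    obtain ⟨d, hd, hds⟩ := h.right_full s hs
    have hconn : (G.induce (insert s C ∪ D)).Connected :=
      connected_induce_union (induce_insert_connected h.connected_left hc hcs).preconnected
        h.connected_right.preconnected (Set.mem_insert _ _) hd hds.symm
    obtain ⟨p, hp⟩ := exists_walk_of_induce_connected hconn (Or.inl (Or.inr ha)) (Or.inr hb)
    obtain ⟨x, hx, hxS⟩ := hsep p
    rcases hp x hx with (rfl | hxC) | hxD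
    · exact hsS' hxS
    · exact h.left_notMem x hxC (hS'.1 hxS)
    · exact h.right_notMem x hxD (hS'.1 hxS)

end IsFullPair

/-- The vertices reachable from `a` by walks avoiding `S`. -/
def compAvoiding {V : Type} (G : SimpleGraph V) (S : Set V) (a : V) : Set V :=
  {v | ∃ p : G.Walk a v, ∀ x ∈ p.support, x ∉ S}

section compAvoiding

variable {V : Type} {G : SimpleGraph V} {S : Set V} {a : V}

lemma self_mem_compAvoiding (ha : a ∉ S) : a ∈ compAvoiding G S a :=
  ⟨Walk.nil, by simpa using ha⟩

lemma notMem_of_mem_compAvoiding {v : V} (hv : v ∈ compAvoiding G S a) : v ∉ S :=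
  let ⟨p, hp⟩ := hv
  hp v p.end_mem_support

lemma mem_compAvoiding_of_adj {v w : V} (hv : v ∈ compAvoiding G S a) (h : G.Adj v w)
    (hw : w ∉ S) : w ∈ compAvoiding G S a := by
  obtain ⟨p, hp⟩ := hv
  refine ⟨p.concat h, fun x hx => ?_⟩
  rw [Walk.support_concat, List.mem_append, List.mem_singleton] at hx
  rcases hx with hx | rfl
  exacts [hp x hx, hw]

lemma compAvoiding_subset {T : Set V} (haT : a ∈ T)
    (hT : ∀ v ∈ T, ∀ w, G.Adj v w → w ∉ S → w ∈ T) : compAvoiding G S a ⊆ T := by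
  rintro v ⟨p, hp⟩
  by_contra hv
  obtain ⟨d, hd, h1, h2⟩ := p.exists_boundary_dart T haT hv
  exact h2 (hT _ h1 _ d.adj (hp _ (p.dart_snd_mem_support_of_mem_darts hd)))

lemma compAvoiding_connected (ha : a ∉ S) : (G.induce (compAvoiding G S a)).Connected := by
  refine induce_connected_iff_exists_adj.2 ⟨⟨a, self_mem_compAvoiding ha⟩, fun U hU hne hUne => ?_⟩
  by_contra! hcon
  have hcl : ∀ u ∈ U, ∀ w, G.Adj u w → w ∉ S → w ∈ U := fun u hu w huw hw => by
    by_contra hwU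
    exact hcon u hu w (mem_compAvoiding_of_adj (hU hu) huw hw) hwU huw
  by_cases haU : a ∈ U
  · exact hUne (hU.antisymm (compAvoiding_subset haU hcl))
  · obtain ⟨u, hu⟩ := hne
    refine compAvoiding_subset (T := compAvoiding G S a \ U) ⟨self_mem_compAvoiding ha, haU⟩ ?_
      (hU hu) |>.2 hu
    exact fun v hv w hvw hw => ⟨mem_compAvoiding_of_adj hv.1 hvw hw, fun hwU =>
      hv.2 (hcl w hwU v hvw.symm (notMem_of_mem_compAvoiding hv.1))⟩

end compAvoiding

lemma IsMinimalSeparator.exists_isFullPair {V : Type} {G : SimpleGraph V} {S : Set V}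
    (hS : IsMinimalSeparator G S) : ∃ C D, IsFullPair G S C D := by
  obtain ⟨a, b, ha, hb, -, -, hsep, hmin⟩ := hS
  have hclosed : ∀ x, ∀ v ∈ compAvoiding G S x, ∀ w, G.Adj v w →
      w ∈ compAvoiding G S x ∨ w ∈ S := fun x v hv w hvw =>
    or_iff_not_imp_right.2 (mem_compAvoiding_of_adj hv hvw)
  have hfull : ∀ x y, (∀ S' ⊂ S, ∃ p : G.Walk x y, ∀ z ∈ p.support, z ∉ S') → x ∉ S →
      y ∉ compAvoiding G S x → ∀ s ∈ S, ∃ c ∈ compAvoiding G S x, G.Adj c s := by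
    intro x y h hx hy s hs
    by_contra! hcon
    obtain ⟨p, hp⟩ := h (S \ {s}) (Set.sdiff_singleton_ssubset.2 hs)
    obtain ⟨d, hd, h1, h2⟩ := p.exists_boundary_dart _ (self_mem_compAvoiding hx) hy
    have h3 := (hclosed x _ h1 _ d.adj).resolve_left h2
    have h4 := hp _ (p.dart_snd_mem_support_of_mem_darts hd)
    have h5 : d.snd = s := by
      by_contra hne
      exact h4 ⟨h3, hne⟩
    exact hcon _ h1 (h5 ▸ d.adj)
  have hba : b ∉ compAvoiding G S a := fun ⟨p, hp⟩ =>
    let ⟨x, hx, hxS⟩ := hsep p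
    hp x hx hxS
  have hab : a ∉ compAvoiding G S b := fun ⟨p, hp⟩ =>
    let ⟨x, hx, hxS⟩ := hsep p.reverse
    hp x (by simpa using hx) hxS
  have hwalk : ∀ S' ⊂ S, ∃ p : G.Walk a b, ∀ z ∈ p.support, z ∉ S' := fun S' hS' => by
    simpa [Separates] using hmin S' hS'
  refine ⟨compAvoiding G S a, compAvoiding G S b, compAvoiding_connected ha,
    compAvoiding_connected hb, ?_, fun _ => notMem_of_mem_compAvoiding,
    fun _ => notMem_of_mem_compAvoiding, hclosed a, hclosed b, hfull a b hwalk ha hba,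
    hfull b a (fun S' hS' => ?_) hb hab⟩
  · rintro v ⟨p, hp⟩ ⟨q, hq⟩
    obtain ⟨x, hx, hxS⟩ := hsep (p.append q.reverse)
    rw [Walk.mem_support_append_iff, Walk.support_reverse, List.mem_reverse] at hx
    exact hx.elim (hp x · hxS) (hq x · hxS)
  · obtain ⟨p, hp⟩ := hwalk S' hS'
    exact ⟨p.reverse, by simpa using hp⟩

/-! ### Dominated separators -/

/-- If `X ⊆ C` dominates `S`, then `S` is the neighbourhood of the component of a vertex of `D` in
the graph obtained by deleting `X` and its neighbours. -/
lemma IsFullPair.eq_of_dominated {V : Type} {G : SimpleGraph V} {S C D X : Set V}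
    (h : IsFullPair G S C D) (hX : X ⊆ C) (hdom : ∀ s ∈ S, ∃ x ∈ X, G.Adj x s) {d : V}
    (hd : d ∈ D) :
    S = {v | v ∉ compAvoiding G (X ∪ {w | ∃ x ∈ X, G.Adj x w}) d ∧
      ∃ u ∈ compAvoiding G (X ∪ {w | ∃ x ∈ X, G.Adj x w}) d, G.Adj u v} := by
  have hDX : ∀ v ∈ D, v ∉ X ∪ {w | ∃ x ∈ X, G.Adj x w} := by
    rintro v hv (hvX | ⟨x, hx, hxv⟩)
    · exact h.notMem_right v (hX hvX) hv
    · exact h.not_adj (hX hx) hv hxv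
  have heq : compAvoiding G (X ∪ {w | ∃ x ∈ X, G.Adj x w}) d = D := by
    refine (compAvoiding_subset hd fun v hv w hvw hw => ?_).antisymm fun v hv => ?_
    · exact (h.right_closed v hv w hvw).resolve_right fun hwS => hw (Or.inr (hdom w hwS))
    · obtain ⟨p, hp⟩ := exists_walk_of_induce_connected h.connected_right hd hv
      exact ⟨p, fun x hx => hDX x (hp x hx)⟩
  rw [heq]
  ext v
  constructor
  · exact fun hv => ⟨fun hvD => h.right_notMem v hvD hv, h.right_full v hv⟩
  · rintro ⟨hvD, u, hu, huv⟩
    exact (h.right_closed u hu v huv).resolve_left hvD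

/-- A class in which every minimal separator is dominated by boundedly many vertices of some full
component is tame. -/
lemma tame_of_dominated (𝒢 : ∀ n : ℕ, SimpleGraph (Fin n) → Prop) (k : ℕ)
    (h𝒢 : ∀ (n : ℕ) (G : SimpleGraph (Fin n)), 𝒢 n G → ∀ S C D, IsFullPair G S C D →
      ∃ X ⊆ C, X.ncard ≤ k ∧ ∀ s ∈ S, ∃ x ∈ X, G.Adj x s) : Tame 𝒢 := by
  refine ⟨Polynomial.X ^ (k + 1 + 1), fun n G hG => ?_⟩
  let F : (Fin (k + 1) → Fin n) × Fin n → Set (Fin n) := fun q =>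
    {v | v ∉ compAvoiding G (Set.range q.1 ∪ {w | ∃ x ∈ Set.range q.1, G.Adj x w}) q.2 ∧
      ∃ u ∈ compAvoiding G (Set.range q.1 ∪ {w | ∃ x ∈ Set.range q.1, G.Adj x w}) q.2, G.Adj u v}
  have hsub : {S : Set (Fin n) | IsMinimalSeparator G S} ⊆ Set.range F := by
    intro S hS
    obtain ⟨C, D, h⟩ := hS.exists_isFullPair
    obtain ⟨X, hXC, hXk, hdom⟩ := h𝒢 n G hG S C D h
    obtain ⟨c, hc⟩ := Set.nonempty_coe_sort.mp h.connected_left.nonempty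
    obtain ⟨d, hd⟩ := Set.nonempty_coe_sort.mp h.connected_right.nonempty
    have hcard : (insert c X).ncard ≤ k + 1 := (Set.ncard_insert_le c X).trans (by omega)
    obtain ⟨f, hf⟩ : ∃ f : Fin (k + 1) → Fin n, Set.range f = insert c X := by
      have hne : Nonempty ↥(insert c X) := ⟨⟨c, Or.inl rfl⟩⟩
      obtain ⟨e⟩ : Nonempty (↥(insert c X) ↪ Fin (k + 1)) := by
        classical
        refine Function.Embedding.nonempty_of_card_le ?_
        rwa [Fintype.card_fin, ← Nat.card_eq_fintype_card, Nat.card_coe_set_eq]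
      refine ⟨fun i => (Function.invFun e i).1, ?_⟩
      ext x
      constructor
      · rintro ⟨i, rfl⟩
        exact (Function.invFun e i).2
      · exact fun hx => ⟨e ⟨x, hx⟩, congrArg Subtype.val
          (Function.leftInverse_invFun e.injective ⟨x, hx⟩)⟩
    refine ⟨(f, d), ?_⟩
    simp only [F, hf]
    exact (h.eq_of_dominated (Set.insert_subset hc hXC)
      (fun s hs => let ⟨x, hx, hxs⟩ := hdom s hs; ⟨x, Or.inr hx, hxs⟩) hd).symm
  calc numMinSep G ≤ (Set.range F).ncard := Set.ncard_le_ncard hsub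
    _ ≤ Nat.card ((Fin (k + 1) → Fin n) × Fin n) := by
      rw [← Set.image_univ, ← Set.ncard_univ]
      exact Set.ncard_image_le
    _ = _ := by simp [pow_succ]

/-! ### Models of the butterfly and the house -/

section Models

variable {V : Type} {G : SimpleGraph V}

lemma inducedMinor_of_forall_lt {n : ℕ} {H : SimpleGraph (Fin n)} (X : Fin n → Set V)
    (hconn : ∀ u, (G.induce (X u)).Connected)
    (hdisj : ∀ u w, u < w → ∀ x ∈ X u, x ∉ X w)
    (hadj : ∀ u w, u < w → H.Adj u w → ∃ a ∈ X u, ∃ b ∈ X w, G.Adj a b)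
    (hnadj : ∀ u w, u < w → ¬ H.Adj u w → ∀ a ∈ X u, ∀ b ∈ X w, ¬ G.Adj a b) :
    InducedMinor H G := by
  refine ⟨X, fun u => Set.nonempty_coe_sort.mp (hconn u).nonempty, hconn, fun u w huw => ?_,
    fun u w huw => ?_, fun u w huw hn => ?_⟩
  · rcases huw.lt_or_gt with h | h
    · exact Set.disjoint_left.2 (hdisj u w h)
    · exact (Set.disjoint_left.2 (hdisj w u h)).symm
  · rcases huw.ne.lt_or_gt with h | h
    · exact hadj u w h huw
    · obtain ⟨a, ha, b, hb, hab⟩ := hadj w u h huw.symm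
      exact ⟨b, hb, a, ha, hab.symm⟩
  · rcases huw.lt_or_gt with h | h
    · exact hnadj u w h hn
    · exact fun a ha b hb hab => hnadj w u h (fun h' => hn h'.symm) b hb a ha hab.symm

lemma inducedMinor_butterfly {Z P₁ P₂ Q₁ Q₂ : Set V}
    (hZ : (G.induce Z).Connected) (hP₁ : (G.induce P₁).Connected) (hP₂ : (G.induce P₂).Connected)
    (hQ₁ : (G.induce Q₁).Connected) (hQ₂ : (G.induce Q₂).Connected)
    (hdisj : ∀ x, (x ∈ Z → x ∉ P₁ ∧ x ∉ P₂ ∧ x ∉ Q₁ ∧ x ∉ Q₂) ∧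
      (x ∈ P₁ → x ∉ P₂ ∧ x ∉ Q₁ ∧ x ∉ Q₂) ∧ (x ∈ P₂ → x ∉ Q₁ ∧ x ∉ Q₂) ∧ (x ∈ Q₁ → x ∉ Q₂))
    (hZP₁ : ∃ a ∈ Z, ∃ b ∈ P₁, G.Adj a b) (hZP₂ : ∃ a ∈ Z, ∃ b ∈ P₂, G.Adj a b)
    (hZQ₁ : ∃ a ∈ Z, ∃ b ∈ Q₁, G.Adj a b) (hZQ₂ : ∃ a ∈ Z, ∃ b ∈ Q₂, G.Adj a b)
    (hP : ∃ a ∈ P₁, ∃ b ∈ P₂, G.Adj a b) (hQ : ∃ a ∈ Q₁, ∃ b ∈ Q₂, G.Adj a b)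
    (hPQ : ∀ a ∈ P₁ ∪ P₂, ∀ b ∈ Q₁ ∪ Q₂, ¬ G.Adj a b) : InducedMinor butterfly G := by
  refine inducedMinor_of_forall_lt ![Z, P₁, P₂, Q₁, Q₂] ?_ ?_ ?_ ?_
  · simp [Fin.forall_fin_succ, *]
  · simp only [Fin.forall_fin_succ]
    simp
    grind
  · simp [Fin.forall_fin_succ, butterfly, *]
  · simp only [Fin.forall_fin_succ]
    simp [butterfly]
    grind

/-- The branch sets `R₁` and `R₂` are the two ends of the chord, `T` is the roof, and `B₁`, `B₂`
are the remaining corners of the square. -/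
lemma inducedMinor_house {T R₁ R₂ B₁ B₂ : Set V}
    (hT : (G.induce T).Connected) (hR₁ : (G.induce R₁).Connected) (hR₂ : (G.induce R₂).Connected)
    (hB₁ : (G.induce B₁).Connected) (hB₂ : (G.induce B₂).Connected)
    (hdisj : ∀ x, (x ∈ T → x ∉ R₁ ∧ x ∉ R₂ ∧ x ∉ B₁ ∧ x ∉ B₂) ∧
      (x ∈ R₁ → x ∉ R₂ ∧ x ∉ B₁ ∧ x ∉ B₂) ∧ (x ∈ R₂ → x ∉ B₁ ∧ x ∉ B₂) ∧ (x ∈ B₁ → x ∉ B₂))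
    (hTR₁ : ∃ a ∈ T, ∃ b ∈ R₁, G.Adj a b) (hTR₂ : ∃ a ∈ T, ∃ b ∈ R₂, G.Adj a b)
    (hR : ∃ a ∈ R₁, ∃ b ∈ R₂, G.Adj a b) (hRB₁ : ∃ a ∈ R₁, ∃ b ∈ B₁, G.Adj a b)
    (hRB₂ : ∃ a ∈ R₂, ∃ b ∈ B₂, G.Adj a b) (hB : ∃ a ∈ B₁, ∃ b ∈ B₂, G.Adj a b)
    (hTB : ∀ a ∈ T, ∀ b ∈ B₁ ∪ B₂, ¬ G.Adj a b) (hRB₁₂ : ∀ a ∈ R₁, ∀ b ∈ B₂, ¬ G.Adj a b)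
    (hRB₂₁ : ∀ a ∈ R₂, ∀ b ∈ B₁, ¬ G.Adj a b) : InducedMinor house G := by
  have hsymm : ∀ {A B : Set V}, (∃ a ∈ A, ∃ b ∈ B, G.Adj a b) → ∃ b ∈ B, ∃ a ∈ A, G.Adj b a :=
    fun ⟨a, ha, b, hb, hab⟩ => ⟨b, hb, a, ha, hab.symm⟩
  refine inducedMinor_of_forall_lt ![R₁, B₁, B₂, R₂, T] ?_ ?_ ?_ ?_
  · simp [Fin.forall_fin_succ, *]
  · simp only [Fin.forall_fin_succ]
    simp
    grind
  · simp [Fin.forall_fin_succ, house, *]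
  · simp only [Fin.forall_fin_succ]
    simp [house]
    grind [SimpleGraph.adj_comm]

end Models

/-! ### Butterfly-free graphs -/

section Butterfly

variable {V : Type} [Finite V] {G : SimpleGraph V} {S C D : Set V}

/-- In a butterfly-free graph, all but an independent subset of a minimal separator is dominated by
two vertices of a full component. -/
lemma IsFullPair.exists_pair_of_butterfly_free (hG : ¬ InducedMinor butterfly G)
    (h : IsFullPair G S C D) : ∃ q₁ ∈ C, ∃ q₂ ∈ C, ∀ s ∈ S, ∀ s' ∈ S, G.Adj s s' →
      G.Adj q₁ s ∨ G.Adj q₂ s ∨ G.Adj q₁ s' ∨ G.Adj q₂ s' := by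
  obtain ⟨c, hc⟩ := Set.nonempty_coe_sort.mp h.connected_left.nonempty
  rcases S.eq_empty_or_nonempty with rfl | ⟨s₀, hs₀⟩
  · exact ⟨c, hc, c, hc, by simp⟩
  obtain ⟨q, hq, hqs⟩ := h.left_full s₀ hs₀
  let T : Set V := {v | v = q ∨ ∀ s ∈ S, ¬ G.Adj v s}
  by_cases hCT : C ⊆ T
  · refine ⟨q, hq, q, hq, fun s hs _ _ _ => Or.inl ?_⟩
    obtain ⟨c, hc, hcs⟩ := h.left_full s hs
    rcases hCT hc with rfl | hc'
    · exact hcs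
    · exact absurd hcs (hc' s hs)
  obtain ⟨U, hUC, hUT, hqU, hU, u, hu, w, hw, hwT, huw⟩ :=
    exists_connected_subset_adj h.connected_left (induce_singleton_connected q)
      (Set.singleton_subset_iff.2 hq) (Set.singleton_subset_iff.2 (Or.inl rfl)) hCT
  rw [Set.singleton_subset_iff] at hqU
  obtain ⟨t, ht, hwt⟩ : ∃ t ∈ S, G.Adj w t := by
    by_contra! hcon
    exact hwT (Or.inr hcon)
  refine ⟨q, hq, w, hw, fun s hs s' hs' hss' => ?_⟩
  by_contra! hcon
  obtain ⟨h1, h2, h3, h4⟩ := hcon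
  obtain ⟨d₀, hd₀, hds₀⟩ := h.right_full s₀ hs₀
  obtain ⟨d₁, hd₁, hdt⟩ := h.right_full t ht
  obtain ⟨d₂, hd₂, hds⟩ := h.right_full s hs
  obtain ⟨d₃, hd₃, hds'⟩ := h.right_full s' hs'
  have hZ : (G.induce (insert t (insert s₀ D))).Connected :=
    induce_insert_connected (induce_insert_connected h.connected_right hd₀ hds₀) (Or.inr hd₁) hdt
  have hUn : ∀ v ∈ U, ∀ r ∈ S, G.Adj v r → G.Adj q r := by
    intro v hv r hr hvr
    rcases hUT hv with rfl | hv'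
    · exact hvr
    · exact absurd hvr (hv' r hr)
  have hwU : w ∉ U := fun hwU => hwT (hUT hwU)
  refine hG (inducedMinor_butterfly hZ (induce_singleton_connected s)
    (induce_singleton_connected s') hU (induce_singleton_connected w) (fun x => ?_)
    ⟨d₂, Or.inr (Or.inr hd₂), s, rfl, hds⟩ ⟨d₃, Or.inr (Or.inr hd₃), s', rfl, hds'⟩
    ⟨s₀, Or.inr (Or.inl rfl), q, hqU, hqs.symm⟩ ⟨t, Or.inl rfl, w, rfl, hwt.symm⟩
    ⟨s, rfl, s', rfl, hss'⟩ ⟨u, hu, w, rfl, huw⟩ ?_)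
  · have := h.left_notMem x
    have := h.right_notMem x
    have := h.notMem_right x
    have := hss'.ne
    have := @hUC x
    simp only [Set.mem_insert_iff, Set.mem_singleton_iff]
    grind
  · rintro a (rfl | rfl) b (hb | rfl) hab
    · exact h1 (hUn b hb a hs hab.symm)
    · exact h2 hab.symm
    · exact h3 (hUn b hb a hs' hab.symm)
    · exact h4 hab.symm

/-- In a butterfly-free graph, every independent subset of a minimal separator is dominated by three
vertices of a full component. -/
lemma IsFullPair.exists_dominating_of_isIndepSet (hG : ¬ InducedMinor butterfly G)
    (h : IsFullPair G S C D) {I : Set V} (hIS : I ⊆ S)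
    (hI : ∀ s ∈ I, ∀ s' ∈ I, ¬ G.Adj s s') :
    ∃ X ⊆ C, X.ncard ≤ 3 ∧ ∀ s ∈ I, ∃ x ∈ X, G.Adj x s := by
  obtain ⟨M, ⟨hMC, hM⟩, hmin⟩ := (Set.toFinite {X : Set V | X ⊆ C ∧
    ∀ s ∈ I, ∃ x ∈ X, G.Adj x s}).exists_minimal ⟨C, subset_rfl, fun s hs => h.left_full s (hIS hs)⟩
  refine ⟨M, hMC, ?_, hM⟩
  by_contra! hcard
  have hpriv : ∀ c ∈ M, ∃ s ∈ I, G.Adj c s ∧ ∀ c' ∈ M, G.Adj c' s → c' = c := by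
    intro c hc
    by_contra! hcon
    refine (hmin (y := M \ {c}) ⟨Set.sdiff_subset.trans hMC, fun s hs => ?_⟩
      Set.sdiff_subset hc).2 rfl
    obtain ⟨x, hx, hxs⟩ := hM s hs
    by_cases hxc : x = c
    · obtain ⟨c', hc', hc's, hne⟩ := hcon s hs (hxc ▸ hxs)
      exact ⟨c', ⟨hc', hne⟩, hc's⟩
    · exact ⟨x, ⟨hx, hxc⟩, hxs⟩
  choose! σ hσI hσ hσp using hpriv
  obtain ⟨i, hi, j, hj, hij, K, hKC, hK, hMK, hiK, hjK, ⟨k₁, hk₁, hik₁⟩, k₂, hk₂, hjk₂⟩ :=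
    exists_connected_avoiding_pair h.connected_left hMC hcard.le
  obtain ⟨l, m, hl, hm, hlm⟩ : ∃ l m, l ∈ M \ {i, j} ∧ m ∈ M \ {i, j} ∧ l ≠ m := by
    have h2 : ({i, j} : Set V).ncard ≤ 2 := (Set.ncard_insert_le i {j}).trans (by simp)
    have h3 := Set.le_ncard_sdiff ({i, j} : Set V) M
    obtain ⟨l, hl, m, hm, hlm⟩ := (Set.one_lt_ncard_iff_nontrivial).1
      (show 1 < (M \ {i, j}).ncard by omega)
    exact ⟨l, m, hl, hm, hlm⟩
  have hinj : ∀ {x y}, x ∈ M → y ∈ M → σ x = σ y → x = y := fun {x y} hx hy hxy =>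
    hσp y hy x hx (hxy ▸ hσ x hx)
  have hnS : ∀ x ∈ C, ∀ y ∈ M, x ≠ σ y := fun x hx y hy hxy =>
    h.left_notMem x hx (hxy ▸ hIS (hσI y hy))
  have hnD : ∀ x ∈ D, ∀ y ∈ M, x ≠ σ y := fun x hx y hy hxy =>
    h.right_notMem x hx (hxy ▸ hIS (hσI y hy))
  have hD : ∀ y ∈ M, ∃ d ∈ D, G.Adj d (σ y) := fun y hy => h.right_full _ (hIS (hσI y hy))
  by_cases hadj : G.Adj i j
  · refine hG (inducedMinor_butterfly
      (induce_insert_connected hK (hMK hm) (hσ m hm.1)) (induce_singleton_connected i)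
      (induce_singleton_connected j) h.connected_right (induce_singleton_connected (σ l))
      (fun x => ?_) ⟨k₁, Or.inr hk₁, i, rfl, hik₁.symm⟩ ⟨k₂, Or.inr hk₂, j, rfl, hjk₂.symm⟩
      ?_ ⟨l, Or.inr (hMK hl), _, rfl, hσ l hl.1⟩ ⟨i, rfl, j, rfl, hadj⟩ ?_ ?_)
    · have h₁ := h.notMem_right x
      have h₂ := fun hx => hnS x hx l hl.1
      have h₃ := fun hx => hnS x hx m hm.1
      have h₄ := fun hx => hnD x hx l hl.1
      have h₅ := fun hx => hnD x hx m hm.1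
      have h₆ : σ l ≠ σ m := fun hh => hlm (hinj hl.1 hm.1 hh)
      have h₇ : x ∈ K → x ∈ C := @hKC x
      have h₈ := hMC hi
      have h₉ := hMC hj
      simp only [Set.mem_insert_iff, Set.mem_singleton_iff]
      clear * - h₁ h₂ h₃ h₄ h₅ h₆ h₇ h₈ h₉ hiK hjK hij
      grind
    · obtain ⟨d, hd, hdm⟩ := hD m hm.1
      exact ⟨_, Or.inl rfl, d, hd, hdm.symm⟩
    · obtain ⟨d, hd, hdl⟩ := hD l hl.1
      exact ⟨d, hd, _, rfl, hdl⟩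
    · rintro a (rfl | rfl) b (hb | rfl) hab
      · exact h.not_adj (hMC hi) hb hab
      · exact hl.2 (Or.inl (hσp l hl.1 _ hi hab).symm)
      · exact h.not_adj (hMC hj) hb hab
      · exact hl.2 (Or.inr (hσp l hl.1 _ hj hab).symm)
  · obtain ⟨dl, hdl, hdl'⟩ := hD l hl.1
    obtain ⟨di, hdi, hdi'⟩ := hD i hi
    obtain ⟨dj, hdj, hdj'⟩ := hD j hj
    have hZ : (G.induce (insert (σ l) K ∪ D)).Connected :=
      connected_induce_union (induce_insert_connected hK (hMK hl) (hσ l hl.1)).preconnected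
        h.connected_right.preconnected (Set.mem_insert _ _) hdl hdl'.symm
    refine hG (inducedMinor_butterfly hZ (induce_singleton_connected i)
      (induce_singleton_connected (σ i)) (induce_singleton_connected j)
      (induce_singleton_connected (σ j)) (fun x => ?_)
      ⟨k₁, Or.inl (Or.inr hk₁), i, rfl, hik₁.symm⟩ ⟨di, Or.inr hdi, _, rfl, hdi'⟩
      ⟨k₂, Or.inl (Or.inr hk₂), j, rfl, hjk₂.symm⟩ ⟨dj, Or.inr hdj, _, rfl, hdj'⟩
      ⟨i, rfl, _, rfl, hσ i hi⟩ ⟨j, rfl, _, rfl, hσ j hj⟩ ?_)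
    · have h₁ := h.notMem_right x
      have h₂ := fun hx => hnS x hx l hl.1
      have h₃ := fun hx => hnS x hx i hi
      have h₄ := fun hx => hnS x hx j hj
      have h₅ := fun hx => hnD x hx i hi
      have h₆ := fun hx => hnD x hx j hj
      have h₇ : σ i ≠ σ j := fun hh => hij (hinj hi hj hh)
      have h₈ : σ l ≠ σ i := fun hh => hl.2 (Or.inl (hinj hl.1 hi hh))
      have h₉ : σ l ≠ σ j := fun hh => hl.2 (Or.inr (hinj hl.1 hj hh))
      have h₁₀ : x ∈ K → x ∈ C := @hKC x
      have h₁₁ := hMC hi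
      have h₁₂ := hMC hj
      simp only [Set.mem_insert_iff, Set.mem_singleton_iff, Set.mem_union]
      clear * - h₁ h₂ h₃ h₄ h₅ h₆ h₇ h₈ h₉ h₁₀ h₁₁ h₁₂ hiK hjK hij
      grind
    · rintro a (rfl | rfl) b (rfl | rfl) hab
      · exact hadj hab
      · exact hij (hσp _ hj _ hi hab)
      · exact hij (hσp _ hi _ hj hab.symm).symm
      · exact hI _ (hσI _ hi) _ (hσI _ hj) hab

lemma IsFullPair.exists_dominating_of_butterfly_free (hG : ¬ InducedMinor butterfly G)
    (h : IsFullPair G S C D) : ∃ X ⊆ C, X.ncard ≤ 5 ∧ ∀ s ∈ S, ∃ x ∈ X, G.Adj x s := by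
  obtain ⟨q₁, hq₁, q₂, hq₂, hq⟩ := h.exists_pair_of_butterfly_free hG
  obtain ⟨X, hXC, hX, hdom⟩ := h.exists_dominating_of_isIndepSet hG
    (I := {s | s ∈ S ∧ ¬ G.Adj q₁ s ∧ ¬ G.Adj q₂ s}) (fun s hs => hs.1)
    (fun s hs s' hs' hss' => by
      have := hq s hs.1 s' hs'.1 hss'
      have := hs.2
      have := hs'.2
      tauto)
  refine ⟨insert q₁ (insert q₂ X), Set.insert_subset hq₁ (Set.insert_subset hq₂ hXC), ?_, ?_⟩
  · have h1 := Set.ncard_insert_le q₁ (insert q₂ X)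
    have h2 := Set.ncard_insert_le q₂ X
    omega
  · intro s hs
    by_cases h1 : G.Adj q₁ s
    · exact ⟨q₁, Or.inl rfl, h1⟩
    by_cases h2 : G.Adj q₂ s
    · exact ⟨q₂, Or.inr (Or.inl rfl), h2⟩
    obtain ⟨x, hx, hxs⟩ := hdom s ⟨hs, h1, h2⟩
    exact ⟨x, Or.inr (Or.inr hx), hxs⟩

end Butterfly

/-! ### House-free graphs -/

section House

variable {V : Type} {G : SimpleGraph V} {S C D : Set V}

lemma IsFullPair.eq_of_house_free (hG : ¬ InducedMinor house G) (h : IsFullPair G S C D)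
    {U : Set V} (hUC : U ⊆ C) (hU : (G.induce U).Connected) {u w : V} (hu : u ∈ U) (hw : w ∈ C)
    (huw : G.Adj u w) {t : V} (ht : t ∈ S) (hwt : G.Adj w t) (hUt : ∀ v ∈ U, ¬ G.Adj v t)
    {r s : V} (hr : r ∈ S) (hUr : ∃ v ∈ U, G.Adj v r) (hwr : ¬ G.Adj w r)
    (hs : s ∈ S) (hUs : ∃ v ∈ U, G.Adj v s) (hws : ¬ G.Adj w s) : r = s := by
  have hwU : w ∉ U := fun hwU => hUt w hwU hwt
  have hne : ∀ {x y}, x ∈ C → y ∈ S → x ≠ y := fun hx hy hxy => h.left_notMem _ hx (hxy ▸ hy)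
  have hnadj : ∀ x ∈ S, (∃ v ∈ U, G.Adj v x) → ¬ G.Adj w x → ¬ G.Adj x t := by
    rintro x hx ⟨v, hv, hvx⟩ hwx hxt
    obtain ⟨d₁, hd₁, hdx⟩ := h.right_full x hx
    obtain ⟨d₂, hd₂, hdt⟩ := h.right_full t ht
    refine hG (inducedMinor_house h.connected_right (induce_singleton_connected x)
      (induce_singleton_connected t) hU (induce_singleton_connected w) (fun y => ?_)
      ⟨d₁, hd₁, x, rfl, hdx⟩ ⟨d₂, hd₂, t, rfl, hdt⟩ ⟨x, rfl, t, rfl, hxt⟩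
      ⟨x, rfl, v, hv, hvx.symm⟩ ⟨t, rfl, w, rfl, hwt.symm⟩ ⟨u, hu, w, rfl, huw⟩ ?_ ?_ ?_)
    · have h₁ := h.notMem_right y
      have h₂ := h.left_notMem y
      have h₃ := h.right_notMem y
      have h₄ : y ∈ U → y ∈ C := @hUC y
      have h₅ := hxt.ne
      simp only [Set.mem_singleton_iff]
      clear * - h₁ h₂ h₃ h₄ h₅ hw hx ht hwU
      grind
    · rintro d hd b (hb | rfl) hdb
      exacts [h.not_adj (hUC hb) hd hdb.symm, h.not_adj hw hd hdb.symm]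
    · rintro _ rfl _ rfl hab
      exact hwx hab.symm
    · rintro _ rfl b hb hab
      exact hUt b hb hab.symm
  by_contra hrs
  obtain ⟨v, hv, hvr⟩ := hUr
  obtain ⟨v', hv', hvs⟩ := hUs
  obtain ⟨d₁, hd₁, hdr⟩ := h.right_full r hr
  obtain ⟨d₂, hd₂, hds⟩ := h.right_full s hs
  obtain ⟨d₃, hd₃, hdt⟩ := h.right_full t ht
  refine hG (inducedMinor_house (induce_singleton_connected r)
    (induce_insert_connected hU hv' hvs) h.connected_right (induce_singleton_connected w)
    (induce_singleton_connected t) (fun y => ?_) ⟨r, rfl, v, Or.inr hv, hvr.symm⟩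
    ⟨r, rfl, d₁, hd₁, hdr.symm⟩ ⟨s, Or.inl rfl, d₂, hd₂, hds.symm⟩ ⟨u, Or.inr hu, w, rfl, huw⟩
    ⟨d₃, hd₃, t, rfl, hdt⟩ ⟨w, rfl, t, rfl, hwt⟩ ?_ ?_ ?_)
  · have h₁ := h.notMem_right y
    have h₂ := h.left_notMem y
    have h₃ := h.right_notMem y
    have h₄ : y ∈ U → y ∈ C := @hUC y
    have h₅ : r ≠ t := by rintro rfl; exact hwr hwt
    have h₆ : s ≠ t := by rintro rfl; exact hws hwt
    simp only [Set.mem_singleton_iff, Set.mem_insert_iff]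
    clear * - h₁ h₂ h₃ h₄ h₅ h₆ hw hr hs ht hwU hrs
    grind (splits := 20)
  · rintro _ rfl _ (rfl | rfl) hab
    exacts [hwr hab.symm, hnadj _ hr ⟨v, hv, hvr⟩ hwr hab]
  · rintro a (rfl | ha) _ rfl hab
    exacts [hnadj _ hs ⟨v', hv', hvs⟩ hws hab, hUt a ha hab]
  · rintro d hd _ rfl hab
    exact h.not_adj hw hd hab.symm

lemma IsFullPair.exists_dominating_of_house_free [Finite V] (hG : ¬ InducedMinor house G)
    (h : IsFullPair G S C D) : ∃ X ⊆ C, X.ncard ≤ 2 ∧ ∀ s ∈ S, ∃ x ∈ X, G.Adj x s := by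
  obtain ⟨c, hc, hmax⟩ := (Set.toFinite C).exists_maximalFor (fun v => {s ∈ S | G.Adj v s}.ncard) C
    (Set.nonempty_coe_sort.mp h.connected_left.nonempty)
  by_cases hCT : C ⊆ {v | ∀ s ∈ S, G.Adj v s → G.Adj c s}
  · refine ⟨{c}, by simpa using hc, by simp, fun s hs => ?_⟩
    obtain ⟨v, hv, hvs⟩ := h.left_full s hs
    exact ⟨c, rfl, hCT hv s hs hvs⟩
  obtain ⟨U, hUC, hUT, hcU, hU, u, hu, w, hw, hwT, huw⟩ :=
    exists_connected_subset_adj h.connected_left (induce_singleton_connected c) (by simpa using hc)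
      (by simp) hCT
  rw [Set.singleton_subset_iff] at hcU
  obtain ⟨t, ht, hwt, hct⟩ : ∃ t ∈ S, G.Adj w t ∧ ¬ G.Adj c t := by simpa using hwT
  by_cases hCT' : C ⊆ {v | ∀ s ∈ S, G.Adj v s → G.Adj c s ∨ G.Adj w s}
  · refine ⟨{c, w}, Set.insert_subset hc (by simpa using hw),
      (Set.ncard_insert_le c {w}).trans (by simp), fun s hs => ?_⟩
    obtain ⟨v, hv, hvs⟩ := h.left_full s hs
    simpa using hCT' hv s hs hvs
  obtain ⟨U', hU'C, hU'T, hUU', hU', u', hu', w', hw', hw'T, huw'⟩ :=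
    exists_connected_subset_adj h.connected_left (induce_insert_connected hU hu huw)
      (Set.insert_subset hw hUC) (by
        rintro v (rfl | hv) s hs hvs
        exacts [Or.inr hvs, Or.inl (hUT hv s hs hvs)]) hCT'
  obtain ⟨t', ht', hwt', hct', hwt''⟩ : ∃ t ∈ S, G.Adj w' t ∧ ¬ G.Adj c t ∧ ¬ G.Adj w t := by
    simpa using hw'T
  have hcU' : c ∈ U' := hUU' (Or.inr hcU)
  have hwU' : w ∈ U' := hUU' (Or.inl rfl)
  let P : Set V := insert t {s ∈ S | G.Adj c s}
  let N : Set V := {s ∈ S | G.Adj w' s}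
  have hP : P.ncard = {s ∈ S | G.Adj c s}.ncard + 1 :=
    Set.ncard_insert_of_notMem fun ht => hct ht.2
  have hPU : ∀ s ∈ P, s ∈ S ∧ ∃ v ∈ U', G.Adj v s := by
    rintro s (rfl | hs)
    exacts [⟨ht, w, hwU', hwt⟩, ⟨hs.1, c, hcU', hs.2⟩]
  have hPN : (P \ N).ncard ≤ 1 := (Set.ncard_le_one (Set.toFinite _)).2 fun r hr s hs =>
    h.eq_of_house_free hG hU'C hU' hu' hw' huw' ht' hwt'
      (fun v hv hvt => (hU'T hv t' ht' hvt).elim hct' hwt'')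
      (hPU r hr.1).1 (hPU r hr.1).2 (fun hh => hr.2 ⟨(hPU r hr.1).1, hh⟩)
      (hPU s hs.1).1 (hPU s hs.1).2 (fun hh => hs.2 ⟨(hPU s hs.1).1, hh⟩)
  have hNP : 0 < (N \ P).ncard := by
    refine (Set.ncard_pos).2 ⟨t', ⟨ht', hwt'⟩, ?_⟩
    rintro (rfl | h')
    exacts [hwt'' hwt, hct' h'.2]
  have h₁ := Set.ncard_inter_add_ncard_sdiff_eq_ncard P N
  have h₂ := Set.ncard_inter_add_ncard_sdiff_eq_ncard N P
  rw [Set.inter_comm] at h₂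
  have h₃ : N.ncard ≤ {s ∈ S | G.Adj c s}.ncard := by
    by_contra! hlt
    exact hlt.not_ge (hmax hw' hlt.le)
  omega

end House

/-! ### Induced minors: general facts -/

lemma InducedMinor.trans {U V W : Type} {A : SimpleGraph W} {B : SimpleGraph V}
    {G : SimpleGraph U} (hAB : InducedMinor A B) (hBG : InducedMinor B G) : InducedMinor A G := by
  obtain ⟨X, hXne, hXc, hXd, hXa, hXn⟩ := hAB
  obtain ⟨Z, hZne, hZc, hZd, hZa, hZn⟩ := hBG
  have hne : ∀ w, (⋃ u ∈ X w, Z u).Nonempty := fun w =>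
    let ⟨u, hu⟩ := hXne w
    let ⟨z, hz⟩ := hZne u
    ⟨z, Set.mem_biUnion hu hz⟩
  refine ⟨fun w => ⋃ u ∈ X w, Z u, hne, fun w => induce_connected_iff_exists_adj.2
    ⟨hne w, fun P hP hPne hPY => ?_⟩, fun w w' hww' => ?_, fun w w' hww' => ?_,
    fun w w' hww' hadj a ha b hb => ?_⟩
  · by_contra! hcon
    have hcl : ∀ u ∈ X w, (Z u ∩ P).Nonempty → Z u ⊆ P := by
      intro u hu huP
      by_contra hsub
      obtain ⟨a, ha, b, hb, hbP, hab⟩ := (induce_connected_iff_exists_adj.1 (hZc u)).2 (Z u ∩ P)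
        Set.inter_subset_left huP fun heq => hsub (Set.inter_eq_left.1 heq)
      exact hcon a ha.2 b (Set.mem_biUnion hu hb) (fun hbP' => hbP ⟨hb, hbP'⟩) hab
    obtain ⟨u, ⟨hu, huP⟩, v, hv, hvP, huv⟩ := (induce_connected_iff_exists_adj.1 (hXc w)).2
      {u ∈ X w | Z u ⊆ P} (Set.sep_subset _ _) (by
        obtain ⟨z, hz⟩ := hPne
        obtain ⟨u, hu, hzu⟩ := Set.mem_iUnion₂.1 (hP hz)
        exact ⟨u, hu, hcl u hu ⟨z, hzu, hz⟩⟩)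
      (fun heq => hPY (hP.antisymm (Set.iUnion₂_subset (Set.sep_eq_self_iff_mem_true.1 heq))))
    obtain ⟨a, ha, b, hb, hab⟩ := hZa u v huv
    by_cases hbP : b ∈ P
    · exact hvP ⟨hv, hcl v hv ⟨b, hb, hbP⟩⟩
    · exact hcon a (huP ha) b (Set.mem_biUnion hv hb) hbP hab
  · refine Set.disjoint_left.2 fun z hz hz' => ?_
    obtain ⟨u, hu, hzu⟩ := Set.mem_iUnion₂.1 hz
    obtain ⟨u', hu', hzu'⟩ := Set.mem_iUnion₂.1 hz'
    have hne : u ≠ u' := by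
      rintro rfl
      exact Set.disjoint_left.1 (hXd hww') hu hu'
    exact Set.disjoint_left.1 (hZd hne) hzu hzu'
  · obtain ⟨u, hu, v, hv, huv⟩ := hXa w w' hww'
    obtain ⟨a, ha, b, hb, hab⟩ := hZa u v huv
    exact ⟨a, Set.mem_biUnion hu ha, b, Set.mem_biUnion hv hb, hab⟩
  · obtain ⟨u, hu, hau⟩ := Set.mem_iUnion₂.1 ha
    obtain ⟨v, hv, hbv⟩ := Set.mem_iUnion₂.1 hb
    have hne : u ≠ v := by
      rintro rfl
      exact Set.disjoint_left.1 (hXd hww') hu hv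
    exact hZn u v hne (hXn w w' hww' hadj u hu v hv) a hau b hbv

lemma SimpleGraph.Embedding.inducedMinor {V W : Type} {H : SimpleGraph W} {G : SimpleGraph V}
    (f : H ↪g G) : InducedMinor H G :=
  ⟨fun w => {f w}, fun _ => Set.singleton_nonempty _, fun _ => induce_singleton_connected _,
    fun u w huw => by simpa using huw, fun u w huw => by simpa using huw,
    fun u w _ hadj => by simpa using hadj⟩

lemma inducedMinor_diamond_house : InducedMinor diamond house := by
  refine inducedMinor_of_forall_lt ![{4}, {0}, {3}, {1, 2}] ?_ ?_ ?_ ?_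
  · have h12 : house.Adj 2 1 := by simp [house]
    simp [Fin.forall_fin_succ, 
      induce_insert_connected (induce_singleton_connected (2 : Fin 5)) rfl h12]
  · simp [Fin.forall_fin_succ]
  · simp [Fin.forall_fin_succ, diamond, house]
  · simp [Fin.forall_fin_succ, diamond, house]

lemma tame_of_inducedMinor {W : Type} {H : SimpleGraph W}
    (h : InducedMinor H butterfly ∨ InducedMinor H house) :
    Tame fun n (G : SimpleGraph (Fin n)) => ¬ InducedMinor H G := by
  rcases h with h | h
  · exact tame_of_dominated _ 5 fun n G hG S C D hSCD =>
      hSCD.exists_dominating_of_butterfly_free fun hb => hG (h.trans hb)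
  · exact tame_of_dominated _ 2 fun n G hG S C D hSCD =>
      hSCD.exists_dominating_of_house_free fun hb => hG (h.trans hb)

open Asymptotics Filter in
lemma Tame.not_feral {𝒢 : ∀ n : ℕ, SimpleGraph (Fin n) → Prop} (h : Tame 𝒢) : ¬ Feral 𝒢 := by
  rintro ⟨c, hc, h𝒢⟩
  obtain ⟨p, hp⟩ := h
  have hlittle : (fun n : ℕ => ((p.eval n : ℕ) : ℝ)) =o[atTop] fun n => c ^ n := by
    simp only [Polynomial.eval_eq_sum_range, Nat.cast_sum, Nat.cast_mul, Nat.cast_pow]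
    exact IsLittleO.fun_sum fun i _ =>
      (isLittleO_pow_const_const_pow_of_one_lt i hc).const_mul_left _
  obtain ⟨N, hN⟩ := eventually_atTop.1 (hlittle.bound (show (0 : ℝ) < 1 / 2 by norm_num))
  obtain ⟨n, hn, G, hG, hcard⟩ := h𝒢 N
  have h₁ : (numMinSep G : ℝ) ≤ p.eval n := by exact_mod_cast hp n G hG
  have h₂ := hN n hn
  have h₃ : 0 < c ^ n := by positivity
  rw [Real.norm_of_nonneg (by positivity), Real.norm_of_nonneg h₃.le] at h₂
  linarith

/-! ### Two families with exponentially many minimal separators -/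

/-- Two stars with `k` leaves each whose leaves are joined by a perfect matching, the two sides
being made complete if `clique` holds. Without `clique` this is the `k`-theta; with `clique` it is
the `(k + 1)`-prism without the matching edge between the centres `(none, false)` and
`(none, true)`. -/
def cappedMatching (k : ℕ) (clique : Prop) : SimpleGraph (Option (Fin k) × Bool) where
  Adj x y := x ≠ y ∧ (x.2 = y.2 ∧ (clique ∨ x.1 = none ∨ y.1 = none) ∨
    x.2 ≠ y.2 ∧ x.1 = y.1 ∧ x.1 ≠ none)
  symm := ⟨fun x y => by grind⟩
  loopless := ⟨fun x => by simp⟩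

lemma cappedMatching_adj {k : ℕ} {clique : Prop} {x y : Option (Fin k) × Bool} :
    (cappedMatching k clique).Adj x y ↔ x ≠ y ∧ (x.2 = y.2 ∧ (clique ∨ x.1 = none ∨ y.1 = none) ∨
      x.2 ≠ y.2 ∧ x.1 = y.1 ∧ x.1 ≠ none) :=
  Iff.rfl

section CappedMatching

variable {V : Type} {k : ℕ} {clique : Prop} (e : V ≃ Option (Fin k) × Bool)

lemma isMinimalSeparator_cappedMatching (σ : Fin k → Bool) :
    IsMinimalSeparator ((cappedMatching k clique).comap e) {v | ∃ i, e v = (some i, σ i)} := by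
  let C : Bool → Set V := fun b => {v | (e v).2 = b ∧ ∀ i, (e v).1 = some i → σ i ≠ b}
  have hcentre : ∀ b, e.symm (none, b) ∈ C b := fun b => by simp [C]
  have hconn : ∀ b, (((cappedMatching k clique).comap e).induce (C b)).Connected := by
    intro b
    refine (connected_iff_exists_forall_reachable _).2 ⟨⟨_, hcentre b⟩, fun v => ?_⟩
    by_cases hv : e v = (none, b)
    · rw [show v = ⟨e.symm (none, b), hcentre b⟩ from Subtype.ext (by simp [← hv])]
    · exact Adj.reachable (by simpa [cappedMatching_adj, v.2.1, eq_comm] using hv)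
  have hclosed : ∀ b, ∀ v ∈ C b, ∀ w, ((cappedMatching k clique).comap e).Adj v w →
      w ∈ C b ∨ w ∈ {v | ∃ i, e v = (some i, σ i)} := by
    rintro b v ⟨hv, hv'⟩ w ⟨-, hvw⟩
    rcases hw : e w with ⟨_ | i, c⟩
    · left
      simp_all [C]
    · by_cases hc : σ i = c
      · exact Or.inr ⟨i, by rw [hw, hc]⟩
      · have hcb : c = b := by
          rcases hvw with ⟨h, -⟩ | ⟨-, h, -⟩
          · rw [← hv, h, hw]
          · have := hv' i (by rw [h, hw])
            cases b <;> cases c <;> simp_all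
        left
        simp_all [C]
  have hfull : ∀ b, ∀ s ∈ {v | ∃ i, e v = (some i, σ i)}, ∃ c ∈ C b,
      ((cappedMatching k clique).comap e).Adj c s := by
    rintro b s ⟨i, hi⟩
    by_cases hb : σ i = b
    · exact ⟨_, hcentre b, by simp [cappedMatching_adj, hi, hb]⟩
    · exact ⟨e.symm (some i, b), by simp [C, hb], by simp [cappedMatching_adj, hi, Ne.symm hb]⟩
  have hnot : ∀ b, ∀ v ∈ C b, v ∉ {v | ∃ i, e v = (some i, σ i)} := by
    rintro b v ⟨hv, hv'⟩ ⟨i, hi⟩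
    exact hv' i (by simp [hi]) (by simp [← hv, hi])
  exact IsFullPair.isMinimalSeparator (C := C false) (D := C true) ⟨hconn _, hconn _,
    fun v hv hv' => by simpa [hv.1] using hv'.1, hnot _, hnot _, hclosed _, hclosed _, hfull _,
    hfull _⟩

lemma two_pow_le_ncard_isMinimalSeparator :
    2 ^ k ≤ {S : Set V | IsMinimalSeparator ((cappedMatching k clique).comap e) S}.ncard := by
  have := Finite.of_equiv _ e.symm
  have hinj : Function.Injective fun σ : Fin k → Bool => {v | ∃ i, e v = (some i, σ i)} := by
    intro σ τ h
    funext i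
    obtain ⟨j, hj⟩ := (Set.ext_iff.1 h (e.symm (some i, σ i))).1 ⟨i, by simp⟩
    simp only [Equiv.apply_symm_apply, Prod.mk.injEq, Option.some.injEq] at hj
    rw [hj.2, hj.1]
  calc 2 ^ k = (Set.range fun σ : Fin k → Bool => {v | ∃ i, e v = (some i, σ i)}).ncard := by
        rw [← Set.image_univ, Set.ncard_image_of_injective _ hinj, Set.ncard_univ]
        simp
    _ ≤ _ := Set.ncard_le_ncard (by
        rintro _ ⟨σ, rfl⟩
        exact isMinimalSeparator_cappedMatching e σ)

end CappedMatching

lemma exists_inducedMinor_cappedMatching {W : Type} {H : SimpleGraph W}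
    (hH : ¬ Feral fun n (G : SimpleGraph (Fin n)) => ¬ InducedMinor H G) (clique : Prop) :
    ∃ k, InducedMinor H (cappedMatching k clique) := by
  by_contra! hcon
  refine hH ⟨11 / 10, by norm_num, fun N => ?_⟩
  have hcard : Fintype.card (Option (Fin (N + 1)) × Bool) = 2 * (N + 2) := by
    simp
    ring
  let e := (Fintype.equivFinOfCardEq hcard).symm
  refine ⟨2 * (N + 2), by omega, (cappedMatching (N + 1) clique).comap e, fun h =>
    hcon (N + 1) (h.trans (Iso.comap e _).toEmbedding.inducedMinor), ?_⟩
  have h₁ : ((2 ^ (N + 1) : ℕ) : ℝ) ≤ _ :=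
    Nat.cast_le.2 (two_pow_le_ncard_isMinimalSeparator (clique := clique) e)
  refine le_trans ?_ h₁
  calc (11 / 10 : ℝ) ^ (2 * (N + 2)) ≤ (11 / 10) ^ (4 * (N + 1)) :=
        pow_le_pow_right₀ (by norm_num) (by omega)
    _ = ((11 / 10) ^ 4) ^ (N + 1) := pow_mul _ _ _
    _ ≤ 2 ^ (N + 1) := pow_le_pow_left₀ (by norm_num) (by norm_num) _
    _ = _ := by push_cast; rfl

/-! ### Co-bipartite induced minors of thetas -/

instance : DecidableRel diamond.Adj := fun _ _ => decidable_of_iff _ (fromRel_adj _ _ _).symm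

instance : DecidableRel butterfly.Adj := fun _ _ => decidable_of_iff _ (fromRel_adj _ _ _).symm

instance : DecidableRel house.Adj := fun _ _ => decidable_of_iff _ (fromRel_adj _ _ _).symm

/-- The adjacency pattern of an induced minor model of a graph in a theta with two paths `a-x-y-b`
and `a-x'-y'-b`. The indices stand for the branch sets containing `a, b, x, y, x', y'`, in this
order, a branch set being assigned to the first of these vertices which it contains. -/
def thetaPattern (e r s r' s' : Bool) : Fin 6 → Fin 6 → Bool :=
  ![![false, e, true, s, true, s'],
    ![e, false, r, true, r', true],
    ![true, r, false, true, false, false],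
    ![s, true, true, false, false, false],
    ![true, r', false, false, false, true],
    ![s', true, false, false, true, false]]

/-- The map `m` embeds the graph with vertex set `P` and adjacency matrix `M` into `G`. -/
def Fits {n : ℕ} (P : Fin 6 → Bool) (M : Fin 6 → Fin 6 → Bool) (G : SimpleGraph (Fin n))
    (m : Fin 6 → Fin n) : Prop :=
  ∀ i j, P i → P j → i < j → m i ≠ m j ∧ (M i j ↔ G.Adj (m i) (m j))

instance {n : ℕ} (P : Fin 6 → Bool) (M : Fin 6 → Fin 6 → Bool) (G : SimpleGraph (Fin n))
    [DecidableRel G.Adj] (m : Fin 6 → Fin n) : Decidable (Fits P M G m) :=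
  inferInstanceAs (Decidable (∀ i j, P i → P j → i < j → m i ≠ m j ∧ (M i j ↔ G.Adj (m i) (m j))))

/-- `v` is a closed walk of length five in the complement of the graph with vertex set `P` and
adjacency matrix `M`. -/
def IsOddAntiwalk (P : Fin 6 → Bool) (M : Fin 6 → Fin 6 → Bool) (v : Fin 5 → Fin 6) : Prop :=
  ∀ i, P (v i) ∧ v i ≠ v (i + 1) ∧ ¬ M (v i) (v (i + 1))

instance (P : Fin 6 → Bool) (M : Fin 6 → Fin 6 → Bool) (v : Fin 5 → Fin 6) :
    Decidable (IsOddAntiwalk P M v) :=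
  inferInstanceAs (Decidable (∀ i, P (v i) ∧ v i ≠ v (i + 1) ∧ ¬ M (v i) (v (i + 1))))

set_option synthInstance.maxSize 2000 in
set_option synthInstance.maxHeartbeats 400000 in
lemma exists_fits_or_isOddAntiwalk : ∀ p₀ p₁ p₂ p₃ p₄ p₅ e r s r' s' : Bool,
    (r → p₁ ∧ p₂ ∧ ¬ p₃) → (s → p₀ ∧ ¬ p₂ ∧ p₃) → (r' → p₁ ∧ p₄ ∧ ¬ p₅) → (s' → p₀ ∧ ¬ p₄ ∧ p₅) →
    (∃ v ∈ [![0, 3, 5, 0, 3], ![1, 2, 4, 1, 2], ![0, 1, 2, 4, 3], ![0, 1, 2, 5, 3],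
        ![0, 1, 4, 2, 5], ![0, 1, 4, 3, 5]],
      IsOddAntiwalk ![p₀, p₁, p₂, p₃, p₄, p₅] (thetaPattern e r s r' s') v) ∨
    (∃ m ∈ [![1, 2, 0, 0, 3, 3]],
      Fits ![p₀, p₁, p₂, p₃, p₄, p₅] (thetaPattern e r s r' s') diamond m) ∨
    (∃ m ∈ [![1, 3, 2, 4, 2, 4], ![0, 0, 1, 2, 3, 4]],
      Fits ![p₀, p₁, p₂, p₃, p₄, p₅] (thetaPattern e r s r' s') butterfly m) ∨
    ∃ m ∈ [![0, 3, 1, 2, 4, 4], ![0, 3, 4, 4, 1, 2], ![0, 2, 1, 1, 3, 3], ![1, 4, 0, 0, 2, 3],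
        ![1, 4, 2, 3, 0, 0], ![0, 1, 4, 2, 4, 2], ![1, 3, 0, 4, 2, 2], ![1, 3, 2, 2, 0, 4]],
      Fits ![p₀, p₁, p₂, p₃, p₄, p₅] (thetaPattern e r s r' s') house m := by
  decide +kernel

section Pattern

variable {W : Type} {H : SimpleGraph W} {t : W → Fin 6} {P : Fin 6 → Bool}
  {M : Fin 6 → Fin 6 → Bool}

lemma Fits.nonempty_embedding {n : ℕ} {G : SimpleGraph (Fin n)} {m : Fin 6 → Fin n}
    (hm : Fits P M G m) (ht : Function.Injective t) (htP : ∀ w, P (t w))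
    (hadj : ∀ u w, t u < t w → (H.Adj u w ↔ M (t u) (t w))) : Nonempty (H ↪g G) := by
  have key : ∀ u w, t u < t w → m (t u) ≠ m (t w) ∧ (H.Adj u w ↔ G.Adj (m (t u)) (m (t w))) :=
    fun u w h => ⟨(hm _ _ (htP u) (htP w) h).1,
      (hadj u w h).trans (hm _ _ (htP u) (htP w) h).2⟩
  refine ⟨⟨⟨fun w => m (t w), fun u w huw => ?_⟩, fun {u w} => ?_⟩⟩
  · by_contra hne
    rcases (ht.ne hne).lt_or_gt with h | h
    exacts [(key u w h).1 huw, (key w u h).1 huw.symm]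
  · by_cases huw : u = w
    · subst huw
      simp
    rcases (ht.ne huw).lt_or_gt with h | h
    · exact (key u w h).2.symm
    · exact ⟨fun h' => ((key w u h).2.2 h'.symm).symm, fun h' => ((key w u h).2.1 h'.symm).symm⟩

lemma not_isOddAntiwalk {v : Fin 5 → Fin 6} (col : W → Bool)
    (hcol : ∀ u w, u ≠ w → col u = col w → H.Adj u w) (htP : ∀ i, P i → ∃ w, t w = i)
    (hM : ∀ i j, M i j = M j i) (hadj : ∀ u w, t u < t w → (H.Adj u w ↔ M (t u) (t w))) :
    ¬ IsOddAntiwalk P M v := by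
  intro hv
  choose x hx using fun i => htP (v i) (hv i).1
  have hne : ∀ i, col (x i) ≠ col (x (i + 1)) := by
    intro i heq
    obtain ⟨-, h₁, h₂⟩ := hv i
    have hxne : x i ≠ x (i + 1) := fun h => h₁ (by rw [← hx, ← hx, h])
    have := hcol _ _ hxne heq
    rw [← hx, ← hx] at h₁ h₂
    rcases h₁.lt_or_gt with h | h
    · exact h₂ ((hadj _ _ h).1 this)
    · exact h₂ (hM _ _ ▸ (hadj _ _ h).1 this.symm)
  have hwalk : ∀ c : Fin 5 → Bool, ¬ ∀ i, c i ≠ c (i + 1) := by decide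
  exact hwalk (fun i => col (x i)) hne

end Pattern

/-- A co-bipartite graph following the pattern of a theta in which no branch set contains both
apices is an induced subgraph of one of the three graphs. -/
lemma nonempty_embedding_of_thetaPattern {W : Type} {H : SimpleGraph W} (col : W → Bool)
    (hcol : ∀ u w, u ≠ w → col u = col w → H.Adj u w) {t : W → Fin 6} (ht : Function.Injective t)
    {e r s r' s' : Bool}
    (hadj : ∀ u w, t u < t w → (H.Adj u w ↔ thetaPattern e r s r' s' (t u) (t w)))
    (hr : r → (∃ w, t w = 1) ∧ (∃ w, t w = 2) ∧ ∀ w, t w ≠ 3)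
    (hs : s → (∃ w, t w = 0) ∧ (∀ w, t w ≠ 2) ∧ ∃ w, t w = 3)
    (hr' : r' → (∃ w, t w = 1) ∧ (∃ w, t w = 4) ∧ ∀ w, t w ≠ 5)
    (hs' : s' → (∃ w, t w = 0) ∧ (∀ w, t w ≠ 4) ∧ ∃ w, t w = 5) :
    Nonempty (H ↪g diamond) ∨ Nonempty (H ↪g butterfly) ∨ Nonempty (H ↪g house) := by
  classical
  let P : Fin 6 → Bool := fun i => decide (∃ w, t w = i)
  have hP : ![P 0, P 1, P 2, P 3, P 4, P 5] = P := by
    funext i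
    fin_cases i <;> rfl
  have htP : ∀ w, P (t w) := fun w => decide_eq_true ⟨w, rfl⟩
  have hsymm : ∀ i j, thetaPattern e r s r' s' i j = thetaPattern e r s r' s' j i := by
    intro i j
    fin_cases i <;> fin_cases j <;> rfl
  have := exists_fits_or_isOddAntiwalk (P 0) (P 1) (P 2) (P 3) (P 4) (P 5) e r s r' s'
    (by simpa [P] using hr) (by simpa [P] using hs) (by simpa [P] using hr')
    (by simpa [P] using hs')
  rw [hP] at this
  rcases this with ⟨v, -, hv⟩ | ⟨m, -, hm⟩ | ⟨m, -, hm⟩ | ⟨m, -, hm⟩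
  · exact absurd hv (not_isOddAntiwalk col hcol (fun i hi => of_decide_eq_true hi) hsymm hadj)
  · exact Or.inl (hm.nonempty_embedding ht htP hadj)
  · exact Or.inr (Or.inl (hm.nonempty_embedding ht htP hadj))
  · exact Or.inr (Or.inr (hm.nonempty_embedding ht htP hadj))

lemma exists_coloring_of_inducedMinor_cappedMatching {W : Type} {H : SimpleGraph W} {k : ℕ}
    (h : InducedMinor H (cappedMatching k True)) :
    ∃ col : W → Bool, ∀ u w, u ≠ w → col u = col w → H.Adj u w := by
  classical
  obtain ⟨X, hne, -, hdisj, -, hnadj⟩ := h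
  choose x hx using hne
  refine ⟨fun w => (x w).2, fun u w huw hcol => ?_⟩
  by_contra hadj
  refine hnadj u w huw hadj _ (hx u) _ (hx w) (cappedMatching_adj.2 ⟨fun heq => ?_, by simp [hcol]⟩)
  exact Set.disjoint_left.1 (hdisj huw) (hx u) (heq ▸ hx w)

/-- In an induced minor model in a theta, a branch set containing no apex lies on a single path. -/
lemma exists_fst_eq_of_connected {k : ℕ} {X : Set (Option (Fin k) × Bool)}
    (hX : ((cappedMatching k False).induce X).Connected) (h : ∀ b, (none, b) ∉ X) :
    ∃ i : Fin k, ∀ x ∈ X, x.1 = some i := by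
  obtain ⟨⟨i, b⟩, hi⟩ := (induce_connected_iff_exists_adj.1 hX).1
  rcases i with _ | i
  · exact absurd hi (h b)
  refine ⟨i, ?_⟩
  by_contra! hcon
  obtain ⟨x, hx, hxi⟩ := hcon
  obtain ⟨u, hu, w, hw, hwi, huw⟩ := (induce_connected_iff_exists_adj.1 hX).2
    {x ∈ X | x.1 = some i} (Set.sep_subset _ _) ⟨_, hi, rfl⟩
    (fun heq => hxi (heq.symm ▸ hx : x ∈ {x ∈ X | x.1 = some i}).2)
  have h₁ := hu.2
  rcases w with ⟨_ | j, c⟩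
  · exact h c hw
  · have h₂ : some j ≠ some i := fun h => hwi ⟨hw, h⟩
    simp_all [cappedMatching_adj, eq_comm]

section ThetaModel

variable {W : Type} {H : SimpleGraph W} {k : ℕ} {X : W → Set (Option (Fin k) × Bool)}

/-- In an induced minor model in a theta of a co-bipartite graph, the branch sets containing no apex
lie on two paths. -/
lemma exists_fst_eq_of_coloring
    (hX : IsInducedMinorModel (cappedMatching k False) H X) {col : W → Bool}
    (hcol : ∀ u w, u ≠ w → col u = col w → H.Adj u w) (q : Bool) :
    ∃ o : Option (Fin k), ∀ w, col w = q → (∀ b, (none, b) ∉ X w) → ∀ x ∈ X w, x.1 = o := by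
  obtain ⟨-, hconn, -, hadj, -⟩ := hX
  by_cases hex : ∃ w, col w = q ∧ ∀ b, (none, b) ∉ X w
  · obtain ⟨u, hu, hu'⟩ := hex
    obtain ⟨i, hi⟩ := exists_fst_eq_of_connected (hconn u) hu'
    refine ⟨some i, fun w hw hw' => ?_⟩
    by_cases huw : u = w
    · exact huw ▸ hi
    obtain ⟨j, hj⟩ := exists_fst_eq_of_connected (hconn w) hw'
    obtain ⟨x, hx, y, hy, hxy⟩ := hadj u w (hcol u w huw (hu.trans hw.symm))
    have hx' := hi x hx
    have hy' := hj y hy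
    have hij : ¬ x.2 = y.2 ∧ i = j := by simpa [cappedMatching_adj, hx', hy'] using hxy.2
    exact hij.2 ▸ hj
  · exact ⟨none, fun w hw hw' => absurd ⟨w, hw, hw'⟩ hex⟩

lemma IsInducedMinorModel.adj_iff {V : Type} {G : SimpleGraph V} {Y : W → Set V}
    (hY : IsInducedMinorModel G H Y) {u w : W} (huw : u ≠ w) :
    H.Adj u w ↔ ∃ a ∈ Y u, ∃ b ∈ Y w, G.Adj a b := by
  obtain ⟨-, -, -, hadj, hnadj⟩ := hY
  refine ⟨hadj u w, fun ⟨a, ha, b, hb, hab⟩ => ?_⟩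
  by_contra h
  exact hnadj u w huw h a ha b hb hab

lemma not_adj_of_fst_ne (hX : IsInducedMinorModel (cappedMatching k False) H X) {u w : W}
    {o o' : Option (Fin k)} (hu : ∀ b, (none, b) ∉ X u) (hw : ∀ b, (none, b) ∉ X w)
    (huo : ∀ x ∈ X u, x.1 = o) (hwo : ∀ x ∈ X w, x.1 = o') (hoo' : o ≠ o') : ¬ H.Adj u w := by
  intro h
  obtain ⟨⟨i, b⟩, hx, ⟨j, c⟩, hy, -, hxy⟩ := hX.2.2.2.1 u w h
  obtain rfl : i = o := huo _ hx
  obtain rfl : j = o' := hwo _ hy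
  rcases hxy with ⟨-, h | rfl | rfl⟩ | ⟨-, h, -⟩
  exacts [h, hu _ hx, hw _ hy, hoo' h]

/-- A branch set not containing the apex on the side of `w` is not adjacent to `w` if the
vertex between them on the path of `w` belongs to a third branch set. -/
lemma not_adj_of_mem (hX : IsInducedMinorModel (cappedMatching k False) H X) {u v w : W} {s : Bool}
    {o : Option (Fin k)} (hu : (none, !s) ∉ X u) (hw : ∀ b, (none, b) ∉ X w)
    (hwo : ∀ x ∈ X w, x.1 = o) (hv : (o, s) ∈ X v) (huv : u ≠ v) (hvw : v ≠ w) : ¬ H.Adj u w := by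
  intro h
  obtain ⟨⟨i, b⟩, hx, ⟨j, c⟩, hy, -, hxy⟩ := hX.2.2.2.1 u w h
  obtain rfl : j = o := hwo _ hy
  have h₁ : c ≠ s := by
    rintro rfl
    exact Set.disjoint_left.1 (hX.2.2.1 hvw) hv hy
  obtain rfl : c = !s := by cases c <;> cases s <;> simp_all
  rcases hxy with ⟨h₂, h | h | h⟩ | ⟨h₂, h, -⟩ <;> simp only at h h₂
  · subst h h₂
    exact hu hx
  · subst h
    exact hw _ hy
  · subst h
    obtain rfl : b = s := by cases b <;> cases s <;> simp_all
    exact Set.disjoint_left.1 (hX.2.2.1 huv) hx hv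

end ThetaModel

/-- A co-bipartite induced minor of a theta is an induced subgraph of one of the three graphs. -/
lemma nonempty_embedding_of_isInducedMinorModel_cappedMatching {W : Type} {H : SimpleGraph W}
    {k : ℕ} {X : W → Set (Option (Fin k) × Bool)}
    (hX : IsInducedMinorModel (cappedMatching k False) H X) (col : W → Bool)
    (hcol : ∀ u w, u ≠ w → col u = col w → H.Adj u w) :
    Nonempty (H ↪g diamond) ∨ Nonempty (H ↪g butterfly) ∨ Nonempty (H ↪g house) := by
  classical
  obtain ⟨o, ho⟩ := exists_fst_eq_of_coloring hX hcol false
  obtain ⟨o', ho'⟩ := exists_fst_eq_of_coloring hX hcol true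
  let c : Fin 6 → Option (Fin k) × Bool :=
    ![(none, false), (none, true), (o, false), (o, true), (o', false), (o', true)]
  have hmeets : ∀ w, ∃ i, c i ∈ X w := by
    intro w
    by_contra! hcon
    have h : ∀ b, (none, b) ∉ X w := by
      rintro (_ | _)
      exacts [hcon 0, hcon 1]
    obtain ⟨⟨i, b⟩, hx⟩ := hX.1 w
    rcases hq : col w with _ | _
    · obtain rfl : i = o := ho w hq h _ hx
      cases b
      exacts [hcon 2 hx, hcon 3 hx]
    · obtain rfl : i = o' := ho' w hq h _ hx
      cases b
      exacts [hcon 4 hx, hcon 5 hx]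
  have hleast : ∀ w, ∃ i, c i ∈ X w ∧ ∀ j < i, c j ∉ X w := by
    intro w
    obtain ⟨i, hi, hmin⟩ := WellFounded.has_min (wellFounded_lt (α := Fin 6)) {i | c i ∈ X w}
      (hmeets w)
    exact ⟨i, hi, fun j hj h => hmin j h hj⟩
  choose t ht hmin using hleast
  have hinj : Function.Injective t := by
    intro u w huw
    by_contra hne
    exact Set.disjoint_left.1 (hX.2.2.1 hne) (ht u) (huw ▸ ht w)
  have hsmall : ∀ w, 1 < t w → ∀ b, (none, b) ∉ X w := by
    rintro w hw (_ | _)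
    exacts [hmin w 0 (hw.trans' Fin.zero_lt_one), hmin w 1 hw]
  have hfiber : ∀ w, 1 < t w → (c (t w)).1 ≠ none ∧ ∀ x ∈ X w, x.1 = (c (t w)).1 := by
    intro w hw
    obtain ⟨i, hi⟩ := exists_fst_eq_of_connected (hX.2.1 w) (hsmall w hw)
    have := hi _ (ht w)
    exact ⟨by simp [this], fun x hx => (hi x hx).trans this.symm⟩
  have hne : ∀ w, 3 < t w → o ≠ o' := by
    rintro w hw rfl
    have h₂ := hmin w 2 (hw.trans' (by decide))
    have h₃ := hmin w 3 hw
    have h := ht w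
    generalize t w = i at hw h
    fin_cases i <;> first | exact absurd hw (by decide) | exact h₂ h | exact h₃ h
  have hedge : ∀ u w, t u < t w → (cappedMatching k False).Adj (c (t u)) (c (t w)) → H.Adj u w :=
    fun u w huw h => (hX.adj_iff (fun h' => huw.ne (congrArg t h'))).2 ⟨_, ht u, _, ht w, h⟩
  have hfix : ∀ e r s r' s' : Bool, ∀ u w, t u < t w →
      (t u = 0 → t w = 1 → (H.Adj u w ↔ e)) → (t u = 1 → t w = 2 → (H.Adj u w ↔ r)) →
      (t u = 0 → t w = 3 → (H.Adj u w ↔ s)) → (t u = 1 → t w = 4 → (H.Adj u w ↔ r')) →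
      (t u = 0 → t w = 5 → (H.Adj u w ↔ s')) →
      (H.Adj u w ↔ thetaPattern e r s r' s' (t u) (t w)) := by
    intro e r s r' s' u w huw he hr hs hr' hs'
    have h₁ := hedge u w huw
    have h₂ : 1 < t u → (c (t u)).1 ≠ (c (t w)).1 → ¬ H.Adj u w := fun h h' =>
      not_adj_of_fst_ne hX (hsmall u h) (hsmall w (h.trans huw)) (hfiber u h).2
        (hfiber w (h.trans huw)).2 h'
    have h₃ := fun h => (hfiber w h).1
    have h₄ := hne w
    generalize t u = i at *
    generalize t w = j at *
    clear hfiber hsmall hedge hmin ht hne hmeets ho ho' hinj hX hcol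
    fin_cases i <;> fin_cases j <;>
      simp_all [thetaPattern, c, cappedMatching_adj, Fin.lt_def, eq_comm]
  by_cases hmerge : ∃ z, (none, false) ∈ X z ∧ (none, true) ∈ X z
  · obtain ⟨z, hz, hz'⟩ := hmerge
    have hzero : ∀ u, t u = 0 → u = z := by
      intro u hu
      by_contra h
      exact Set.disjoint_left.1 (hX.2.2.1 h) (show (none, false) ∈ X u by simpa [hu, c] using ht u)
        hz
    have hone : ∀ u, t u ≠ 1 := by
      intro u hu
      by_cases h : u = z
      · exact hmin u 0 (by simp [hu]) (h ▸ hz)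
      · exact Set.disjoint_left.1 (hX.2.2.1 h)
          (show (none, true) ∈ X u by simpa [hu, c] using ht u) hz'
    have hcentre : ∀ u w, t u = 0 → t w = 3 ∨ t w = 5 → H.Adj u w := by
      intro u w hu hw
      refine (hX.adj_iff fun h => ?_).2 ⟨(none, true), hzero u hu ▸ hz', _, ht w, ?_⟩
      · rw [h] at hu
        rcases hw with hw | hw <;> exact absurd (hu.symm.trans hw) (by decide)
      · have h := (hfiber w (by rcases hw with hw | hw <;> rw [hw] <;> decide)).1
        rcases hw with hw | hw <;> rw [hw] at h ⊢ <;>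
          exact ⟨fun heq => h (congrArg Prod.fst heq).symm, Or.inl ⟨rfl, Or.inr (Or.inl rfl)⟩⟩
    refine Or.inr (Or.inl (Fits.nonempty_embedding (P := fun i => decide (i ≠ 1))
      (M := thetaPattern false false true false true) (m := ![0, 0, 1, 2, 3, 4]) (by decide) hinj
      (fun w => by simpa using hone w) fun u w huw => hfix _ _ _ _ _ u w huw ?_ ?_ ?_ ?_ ?_))
    · exact fun _ h => absurd h (hone w)
    · exact fun h => absurd h (hone u)
    · exact fun hu hw => iff_of_true (hcentre u w hu (Or.inl hw)) rfl
    · exact fun h => absurd h (hone u)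
    · exact fun hu hw => iff_of_true (hcentre u w hu (Or.inr hw)) rfl
  · push Not at hmerge
    have hthird : ∀ {i j l : Fin 6} {b : Bool}, c i = (none, b) → c l = ((c j).1, b) → 1 < j →
        l ≠ i → l ≠ j → (∃ u w, t u = i ∧ t w = j ∧ H.Adj u w) →
        (∃ u, t u = i) ∧ (∃ w, t w = j) ∧ ∀ v, t v ≠ l := by
      rintro i j l b hi hl hj hli hlj ⟨u, w, rfl, rfl, huw⟩
      refine ⟨⟨u, rfl⟩, ⟨w, rfl⟩, fun v hv => not_adj_of_mem hX (s := b) ?_ (hsmall w hj)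
        (hfiber w hj).2 (hl ▸ hv ▸ ht v) ?_ ?_ huw⟩
      · have := hi ▸ ht u
        cases b
        exacts [hmerge u this, fun h => hmerge u h this]
      · rintro rfl
        exact hli hv.symm
      · rintro rfl
        exact hlj hv.symm
    have hiff : ∀ {i j : Fin 6} {u w : W}, t u = i → t w = j →
        (H.Adj u w ↔ decide (∃ u w, t u = i ∧ t w = j ∧ H.Adj u w)) := by
      intro i j u w hu hw
      rw [decide_eq_true_iff]
      refine ⟨fun h => ⟨u, w, hu, hw, h⟩, fun ⟨u', w', hu', hw', h⟩ => ?_⟩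
      rwa [hinj (hu.trans hu'.symm), hinj (hw.trans hw'.symm)]
    refine nonempty_embedding_of_thetaPattern col hcol hinj
      (e := decide (∃ u w, t u = 0 ∧ t w = 1 ∧ H.Adj u w))
      (r := decide (∃ u w, t u = 1 ∧ t w = 2 ∧ H.Adj u w))
      (s := decide (∃ u w, t u = 0 ∧ t w = 3 ∧ H.Adj u w))
      (r' := decide (∃ u w, t u = 1 ∧ t w = 4 ∧ H.Adj u w))
      (s' := decide (∃ u w, t u = 0 ∧ t w = 5 ∧ H.Adj u w))
      (fun u w huw => hfix _ _ _ _ _ u w huw hiff hiff hiff hiff hiff) ?_ ?_ ?_ ?_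
    · exact fun h => hthird (b := true) rfl rfl (by decide) (by decide) (by decide)
        (of_decide_eq_true h)
    · intro h
      obtain ⟨h₁, h₂, h₃⟩ := hthird (l := 2) (b := false) rfl rfl (by decide)
        (by decide) (by decide) (of_decide_eq_true h)
      exact ⟨h₁, h₃, h₂⟩
    · exact fun h => hthird (b := true) rfl rfl (by decide) (by decide) (by decide)
        (of_decide_eq_true h)
    · intro h
      obtain ⟨h₁, h₂, h₃⟩ := hthird (l := 4) (b := false) rfl rfl (by decide)
        (by decide) (by decide) (of_decide_eq_true h)
      exact ⟨h₁, h₃, h₂⟩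

theorem dichotomy_induced_minor {W : Type} [Fintype W] (H : SimpleGraph W) :
    List.TFAE
      [ Tame (fun n (G : SimpleGraph (Fin n)) => ¬ InducedMinor H G),
        ¬ Feral (fun n (G : SimpleGraph (Fin n)) => ¬ InducedMinor H G),
        Nonempty (H ↪g diamond) ∨ Nonempty (H ↪g butterfly) ∨ Nonempty (H ↪g house),
        InducedMinor H butterfly ∨ InducedMinor H house ] := by
  tfae_have 1 → 2 := Tame.not_feral
  tfae_have 2 → 3 := by
    intro h
    obtain ⟨_, hprism⟩ := exists_inducedMinor_cappedMatching h True
    obtain ⟨_, _, hX⟩ := exists_inducedMinor_cappedMatching h False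
    obtain ⟨col, hcol⟩ := exists_coloring_of_inducedMinor_cappedMatching hprism
    exact nonempty_embedding_of_isInducedMinorModel_cappedMatching hX col hcol
  tfae_have 3 → 4 := by
    rintro (⟨⟨f⟩⟩ | ⟨⟨f⟩⟩ | ⟨⟨f⟩⟩)
    exacts [Or.inr (f.inducedMinor.trans inducedMinor_diamond_house), Or.inl f.inducedMinor,
      Or.inr f.inducedMinor]
  tfae_have 4 → 1 := tame_of_inducedMinor
  tfae_finish
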